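/- Let τ belong to class 𝒯 with unique absolutely continuous invariant probability density h (P_τ h = h). Then the fixed space E₁ = {f ∈ L¹(m) : P_τ f = f} is one-dimensional (spanned by h), and E₁ ⊆ BV_I, i.e., every fixed point of P_τ in L¹ has a version of bounded variation. -/

import Mathlib

open Set Filter MeasureTheory Topology

structure PCT where
  τ : ℝ → ℝ
  a : ℕ → ℝ
  b : ℕ → ℝ
  da : ℕ → ℝ
  maps_to : Set.MapsTo τ (Set.Icc 0 1) (Set.Icc 0 1)
  lt : ∀ i, a i < b i
  sub : ∀ i, Set.Ioo (a i) (b i) ⊆ Set.Icc (0:ℝ) 1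
  disj : Pairwise (Function.onFun Disjoint fun i => Set.Ioo (a i) (b i))
  null : volume (Set.Icc (0:ℝ) 1 \ ⋃ i, Set.Ioo (a i) (b i)) = 0
  mono : ∀ i, StrictMonoOn τ (Set.Ioo (a i) (b i))
  conv : ∀ i, ConvexOn ℝ (Set.Ioo (a i) (b i)) τ
  diff : ∀ i, ∀ x ∈ Set.Ioo (a i) (b i), DifferentiableAt ℝ τ x
  lim_zero : ∀ i, Filter.Tendsto τ (nhdsWithin (a i) (Set.Ioi (a i))) (nhds 0)
  deriv_lim : ∀ i, Filter.Tendsto (deriv τ) (nhdsWithin (a i) (Set.Ioi (a i))) (nhds (da i))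
  da_pos : ∀ i, 0 < da i
  sum_inv : Summable (fun i => 1 / da i)
  expand : (¬ AccPt (0:ℝ) (Filter.principal (Set.range a))) → ∃ i, a i = 0 ∧ 1 < da i

/-- The interval `(c,d)` follows a single sequence of branches under the first `n`
iterates of `τ`. -/
def IsBranchSeq (T : PCT) (n : ℕ) (c d : ℝ) : Prop :=
  c < d ∧ ∀ k < n, ∃ i, T.τ^[k] '' Set.Ioo c d ⊆ Set.Ioo (T.a i) (T.b i)

/-- `(c,d)` is a maximal open interval on which `τ^n` is a single monotone branch,
i.e. an element of the partition `𝒫⁽ⁿ⁾`. -/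
def IsBranchInterval (T : PCT) (n : ℕ) (c d : ℝ) : Prop :=
  IsBranchSeq T n c d ∧
    ∀ c' d', c' ≤ c → d ≤ d' → IsBranchSeq T n c' d' → c' = c ∧ d' = d

/-- The limit of the Cesàro averages of a sequence along a fixed nonprincipal ultrafilter. -/
noncomputable def cesaroLim (s : ℕ → ℝ) : ℝ :=
  limUnder (hyperfilter ℕ : Filter ℕ) (fun n : ℕ => (∑ k ∈ Finset.range n, s k) / n)

theorem abs_average_le {s : ℕ → ℝ} {C : ℝ} (hs : ∀ n, |s n| ≤ C) (n : ℕ) :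
    |(∑ k ∈ Finset.range n, s k) / n| ≤ C := by
  have hC : 0 ≤ C := (abs_nonneg _).trans (hs 0)
  rw [abs_div, Nat.abs_cast]
  refine div_le_of_le_mul₀ (Nat.cast_nonneg n) hC ?_
  calc |∑ k ∈ Finset.range n, s k| ≤ ∑ k ∈ Finset.range n, |s k| := Finset.abs_sum_le_sum_abs _ _
    _ ≤ ∑ k ∈ Finset.range n, C := Finset.sum_le_sum fun k _ => hs k
    _ = C * n := by simp [mul_comm]

theorem tendsto_cesaroLim {s : ℕ → ℝ} {C : ℝ} (hs : ∀ n, |s n| ≤ C) :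
    Tendsto (fun n : ℕ => (∑ k ∈ Finset.range n, s k) / n) (hyperfilter ℕ) (𝓝 (cesaroLim s)) := by
  apply tendsto_nhds_limUnder
  have hmem : ∀ n : ℕ, (∑ k ∈ Finset.range n, s k) / n ∈ Icc (-C) C := fun n =>
    abs_le.1 (abs_average_le hs n)
  obtain ⟨x, -, hx⟩ := (isCompact_Icc (a := -C) (b := C)).ultrafilter_le_nhds
    ((hyperfilter ℕ).map fun n : ℕ => (∑ k ∈ Finset.range n, s k) / n)
    (le_principal_iff.2 (Eventually.of_forall (f := (hyperfilter ℕ : Filter ℕ)) hmem))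
  exact ⟨x, hx⟩

theorem cesaroLim_add {s t : ℕ → ℝ} {C D : ℝ} (hs : ∀ n, |s n| ≤ C) (ht : ∀ n, |t n| ≤ D) :
    cesaroLim (fun n => s n + t n) = cesaroLim s + cesaroLim t := by
  have hst : ∀ n, |s n + t n| ≤ C + D := fun n =>
    (abs_add_le _ _).trans (add_le_add (hs n) (ht n))
  refine tendsto_nhds_unique (tendsto_cesaroLim hst) ?_
  refine ((tendsto_cesaroLim hs).add (tendsto_cesaroLim ht)).congr fun n => ?_
  rw [Finset.sum_add_distrib, add_div]

theorem cesaroLim_const_mul {s : ℕ → ℝ} {C : ℝ} (hs : ∀ n, |s n| ≤ C) (c : ℝ) :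
    cesaroLim (fun n => c * s n) = c * cesaroLim s := by
  have hst : ∀ n, |c * s n| ≤ |c| * C := fun n => by
    rw [abs_mul]; exact mul_le_mul_of_nonneg_left (hs n) (abs_nonneg c)
  refine tendsto_nhds_unique (tendsto_cesaroLim hst) ?_
  refine ((tendsto_cesaroLim hs).const_mul c).congr fun n => ?_
  rw [← Finset.mul_sum, mul_div_assoc]

theorem cesaroLim_le_cesaroLim {s t : ℕ → ℝ} {C D : ℝ} (hs : ∀ n, |s n| ≤ C)
    (ht : ∀ n, |t n| ≤ D) (h : ∀ n, s n ≤ t n) : cesaroLim s ≤ cesaroLim t :=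
  le_of_tendsto_of_tendsto' (tendsto_cesaroLim hs) (tendsto_cesaroLim ht) fun n =>
    div_le_div_of_nonneg_right (Finset.sum_le_sum fun k _ => h k) (Nat.cast_nonneg n)

theorem abs_cesaroLim_le {s : ℕ → ℝ} {C : ℝ} (hs : ∀ n, |s n| ≤ C) : |cesaroLim s| ≤ C :=
  le_of_tendsto' (tendsto_cesaroLim hs).abs (abs_average_le hs)

theorem cesaroLim_const (c : ℝ) : cesaroLim (fun _ => c) = c := by
  refine tendsto_nhds_unique (tendsto_cesaroLim (s := fun _ => c) fun _ => le_rfl) ?_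
  refine Tendsto.mono_left ?_ Nat.hyperfilter_le_atTop
  refine tendsto_const_nhds.congr' ?_
  filter_upwards [eventually_gt_atTop 0] with n hn
  have : (n : ℝ) ≠ 0 := by positivity
  simp [this]

theorem cesaroLim_succ {s : ℕ → ℝ} {C : ℝ} (hs : ∀ n, |s n| ≤ C) :
    cesaroLim (fun n => s (n + 1)) = cesaroLim s := by
  refine tendsto_nhds_unique (tendsto_cesaroLim (fun n => hs (n + 1))) ?_
  have h0 : Tendsto (fun n : ℕ => (s n - s 0) / n) (hyperfilter ℕ) (𝓝 0) := by
    refine Tendsto.mono_left ?_ Nat.hyperfilter_le_atTop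
    refine squeeze_zero_norm (a := fun n : ℕ => (C + C) / n) (fun n => ?_)
      (tendsto_const_div_atTop_nhds_zero_nat _)
    rw [Real.norm_eq_abs, abs_div, Nat.abs_cast]
    exact div_le_div_of_nonneg_right
      ((abs_sub _ _).trans (add_le_add (hs n) (hs 0))) (Nat.cast_nonneg n)
  have := (tendsto_cesaroLim hs).add h0
  rw [add_zero] at this
  refine this.congr fun n => ?_
  rw [← add_div]
  congr 1
  have := Finset.sum_range_succ s n
  have := Finset.sum_range_succ' s n
  linarith

/-- A finitely additive set function dominated by a finite measure vanishes on Borel sets as soon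
as it vanishes on half-lines. -/
theorem eq_zero_of_additive_of_Iic {μ : Measure ℝ} [IsFiniteMeasure μ] {d : Set ℝ → ℝ} {C : ℝ}
    (hadd : ∀ A B, MeasurableSet A → MeasurableSet B → Disjoint A B → d (A ∪ B) = d A + d B)
    (hle : ∀ A, MeasurableSet A → |d A| ≤ C * μ.real A)
    (huniv : d univ = 0) (hIic : ∀ y, d (Iic y) = 0) {A : Set ℝ} (hA : MeasurableSet A) :
    d A = 0 := by
  have hempty : d ∅ = 0 := by simpa using hle ∅ MeasurableSet.empty
  induction A, hA using MeasurableSpace.induction_on_inter (borel_eq_generateFrom_Iic ℝ)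
    isPiSystem_Iic with
  | empty => exact hempty
  | basic t ht => obtain ⟨q, rfl⟩ := ht; exact hIic q
  | compl t ht iht =>
    have := hadd t tᶜ ht ht.compl disjoint_compl_right
    rw [union_compl_self, huniv, iht] at this
    linarith
  | iUnion f hd hm ih =>
    have hpart : ∀ n : ℕ, d (⋃ i, f i) = d (⋃ i, f (i + n)) := by
      intro n
      induction n with
      | zero => rfl
      | succ n ihn =>
        rw [ihn]
        have hsplit : (⋃ i, f (i + n)) = f n ∪ ⋃ i, f (i + (n + 1)) := by
          rw [← union_iUnion_nat_succ]
          simp [add_assoc, add_comm 1]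
        rw [hsplit, hadd _ _ (hm n) (MeasurableSet.iUnion fun i => hm _)
          (disjoint_iUnion_right.2 fun i => hd (by omega)), ih n, zero_add]
    have hlim : Tendsto (fun n : ℕ => C * μ.real (⋃ i, f (i + n))) atTop (𝓝 (C * 0)) := by
      refine Tendsto.const_mul _ ?_
      have := tendsto_measure_biUnion_Ici_zero_of_pairwise_disjoint (μ := μ)
        (fun i => (hm i).nullMeasurableSet) hd
      have h2 := (ENNReal.tendsto_toReal ENNReal.zero_ne_top).comp this
      refine h2.congr fun n => ?_
      simp only [Function.comp, measureReal_def]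
      congr 2
      ext x
      simp only [mem_iUnion, exists_prop]
      constructor
      · rintro ⟨i, hi, hx⟩
        exact ⟨i - n, by rwa [Nat.sub_add_cancel hi]⟩
      · rintro ⟨i, hx⟩
        exact ⟨i + n, by omega, hx⟩
    rw [mul_zero] at hlim
    have : |d (⋃ i, f i)| ≤ 0 := ge_of_tendsto' hlim fun n => by
      rw [hpart n]; exact hle _ (MeasurableSet.iUnion fun i => hm _)
    exact abs_nonpos_iff.1 this

/-- Concave distribution functions on the unit interval, with slope at most `M`. -/
structure IsConcaveCDF (M : ℝ) (F : ℝ → ℝ) : Prop where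
  concave : ConcaveOn ℝ (Icc 0 1) F
  mono : MonotoneOn F (Icc 0 1)
  zero : F 0 = 0
  le_mul : ∀ y ∈ Icc (0 : ℝ) 1, F y ≤ M * y
  le_one : F 1 ≤ 1

namespace IsConcaveCDF

variable {M : ℝ} {F : ℝ → ℝ}

theorem sub_le_div_mul (hF : IsConcaveCDF M F) {x y : ℝ} (hx : 0 < x) (hxy : x ≤ y)
    (hy : y ≤ 1) : F y - F x ≤ F x / x * (y - x) := by
  rcases hxy.eq_or_lt with rfl | hxy
  · simp
  have := hF.concave.slope_anti_adjacent (x := 0) (z := y) ⟨le_rfl, zero_le_one⟩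
    ⟨(hx.trans hxy).le, hy⟩ hx hxy
  rw [hF.zero, sub_zero, sub_zero] at this
  rwa [div_le_iff₀ (sub_pos.2 hxy)] at this

theorem sub_le_mul (hF : IsConcaveCDF M F) {x y : ℝ} (hx : 0 ≤ x) (hxy : x ≤ y)
    (hy : y ≤ 1) : F y - F x ≤ M * (y - x) := by
  rcases hx.eq_or_lt with rfl | hx
  · simpa [hF.zero] using hF.le_mul y ⟨hxy, hy⟩
  refine (hF.sub_le_div_mul hx hxy hy).trans
    (mul_le_mul_of_nonneg_right ?_ (sub_nonneg.2 hxy))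
  rw [div_le_iff₀ hx]
  exact hF.le_mul x ⟨hx.le, hxy.trans hy⟩

theorem continuousOn (hF : IsConcaveCDF M F) : ContinuousOn F (Icc 0 1) := by
  have key : ∀ x ∈ Icc (0 : ℝ) 1, ∀ y ∈ Icc (0 : ℝ) 1, x ≤ y →
      |F x - F y| ≤ M.toNNReal * |x - y| := by
    intro x hx y hy hxy
    rw [abs_sub_comm, abs_sub_comm x, abs_of_nonneg (sub_nonneg.2 (hF.mono hx hy hxy)),
      abs_of_nonneg (sub_nonneg.2 hxy)]
    exact (hF.sub_le_mul hx.1 hxy hy.2).trans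
      (mul_le_mul_of_nonneg_right (Real.le_coe_toNNReal M) (sub_nonneg.2 hxy))
  refine (LipschitzOnWith.of_dist_le_mul (K := M.toNNReal) fun x hx y hy => ?_).continuousOn
  rw [Real.dist_eq, Real.dist_eq]
  rcases le_total x y with h | h
  · exact key x hx y hy h
  · rw [abs_sub_comm, abs_sub_comm x]
    exact key y hy x hx h

/-- A concave distribution function is the primitive of a bounded decreasing density. -/
theorem exists_density (hF : IsConcaveCDF M F) :
    ∃ g : ℝ → ℝ, Antitone g ∧ (∀ x ∈ Ioo (0 : ℝ) 1, 0 ≤ g x ∧ g x ≤ M) ∧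
      ∀ y ∈ Icc (0 : ℝ) 1, ∫ t in (0 : ℝ)..y, g t = F y := by
  have hconv : ConvexOn ℝ (Icc 0 1) (-F) := hF.concave.neg
  have hderiv : ∀ x ∈ Ioo (0 : ℝ) 1,
      HasDerivWithinAt F (-derivWithin (-F) (Ioi x) x) (Ioi x) x := by
    intro x hx
    have := (hconv.hasDerivWithinAt_rightDeriv_of_mem_interior
      (by rwa [interior_Icc])).neg
    simpa using this
  have hanti : AntitoneOn (fun x => -derivWithin (-F) (Ioi x) x) (Ioo 0 1) := by
    have := hconv.monotoneOn_rightDeriv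
    rw [interior_Icc] at this
    exact this.neg
  have hbound : ∀ x ∈ Ioo (0 : ℝ) 1, 0 ≤ -derivWithin (-F) (Ioi x) x ∧
      -derivWithin (-F) (Ioi x) x ≤ M := by
    intro x hx
    have hlim := (hasDerivWithinAt_iff_tendsto_slope' (by simp)).1 (hderiv x hx)
    have hev : ∀ᶠ y in 𝓝[>] x, 0 ≤ slope F x y ∧ slope F x y ≤ M := by
      filter_upwards [Ioo_mem_nhdsGT hx.2] with y hy
      rw [slope_def_field]
      have hpos := sub_pos.2 hy.1
      exact ⟨div_nonneg (sub_nonneg.2 (hF.mono ⟨hx.1.le, hx.2.le⟩ ⟨(hx.1.trans hy.1).le, hy.2.le⟩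
        hy.1.le)) hpos.le, (div_le_iff₀ hpos).2 (hF.sub_le_mul hx.1.le hy.1.le hy.2.le)⟩
    exact ⟨ge_of_tendsto hlim (hev.mono fun _ h => h.1),
      le_of_tendsto hlim (hev.mono fun _ h => h.2)⟩
  obtain ⟨g, hg, hgeq⟩ := hanti.exists_antitone_extension
    ⟨0, by rintro _ ⟨x, hx, rfl⟩; exact (hbound x hx).1⟩
    ⟨M, by rintro _ ⟨x, hx, rfl⟩; exact (hbound x hx).2⟩
  refine ⟨g, hg, fun x hx => by rw [← hgeq hx]; exact hbound x hx, fun y hy => ?_⟩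
  have := intervalIntegral.integral_eq_sub_of_hasDeriv_right_of_le hy.1
    (hF.continuousOn.mono (Icc_subset_Icc_right hy.2))
    (fun x hx => by
      have hx' : x ∈ Ioo (0 : ℝ) 1 := ⟨hx.1, hx.2.trans_le hy.2⟩
      have := hderiv x hx'
      rwa [show -derivWithin (-F) (Ioi x) x = g x from hgeq hx'] at this)
    hg.intervalIntegrable
  rw [this, hF.zero, sub_zero]

end IsConcaveCDF

namespace PCT

variable (T : PCT)

theorem a_nonneg (i : ℕ) : 0 ≤ T.a i := by
  by_contra! h
  obtain ⟨x, hx1, hx2⟩ := exists_between (lt_min (T.lt i) h)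
  exact absurd (T.sub i ⟨hx1, hx2.trans_le (min_le_left _ _)⟩).1
    (not_le.2 (hx2.trans_le (min_le_right _ _)))

theorem b_le_one (i : ℕ) : T.b i ≤ 1 := by
  by_contra! h
  obtain ⟨x, hx1, hx2⟩ := exists_between (max_lt (T.lt i) h)
  exact absurd (T.sub i ⟨(le_max_left _ _).trans_lt hx1, hx2⟩).2
    (not_le.2 ((le_max_right _ _).trans_lt hx1))

theorem b_le_a {i j : ℕ} (hij : i ≠ j) (h : T.a i ≤ T.a j) : T.b i ≤ T.a j := by
  by_contra! hlt
  obtain ⟨x, hx1, hx2⟩ := exists_between (lt_min hlt (T.lt j))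
  exact disjoint_left.1 (T.disj hij) ⟨h.trans_lt hx1, hx2.trans_le (min_le_left _ _)⟩
    ⟨hx1, hx2.trans_le (min_le_right _ _)⟩

variable {T} {i : ℕ} {x y : ℝ}

theorem continuousAt (hx : x ∈ Ioo (T.a i) (T.b i)) : ContinuousAt T.τ x :=
  (T.diff i x hx).continuousAt

theorem da_le_deriv (hx : x ∈ Ioo (T.a i) (T.b i)) : T.da i ≤ deriv T.τ x := by
  refine le_of_tendsto (T.deriv_lim i) ?_
  filter_upwards [Ioo_mem_nhdsGT hx.1] with z hz
  exact (T.conv i).monotoneOn_deriv (T.diff i) ⟨hz.1, hz.2.trans hx.2⟩ hx hz.2.le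

theorem da_mul_le_sub (hx : x ∈ Ioo (T.a i) (T.b i)) (hy : y ∈ Ioo (T.a i) (T.b i))
    (hxy : x ≤ y) : T.da i * (y - x) ≤ T.τ y - T.τ x :=
  (convex_Ioo _ _).mul_sub_le_image_sub_of_le_deriv
    (fun _ hz => (continuousAt hz).continuousWithinAt)
    (fun z hz => (T.diff i z (interior_subset hz)).differentiableWithinAt)
    (fun _ hz => da_le_deriv (interior_subset hz)) x hx y hy hxy

theorem da_mul_le (hx : x ∈ Ioo (T.a i) (T.b i)) : T.da i * (x - T.a i) ≤ T.τ x := by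
  have h1 : Tendsto (fun z => T.da i * (x - z)) (𝓝[>] T.a i) (𝓝 (T.da i * (x - T.a i))) :=
    ((continuous_const.mul (continuous_const.sub continuous_id)).tendsto _).mono_left
      nhdsWithin_le_nhds
  have h2 : Tendsto (fun z => T.τ x - T.τ z) (𝓝[>] T.a i) (𝓝 (T.τ x - 0)) :=
    tendsto_const_nhds.sub (T.lim_zero i)
  rw [sub_zero] at h2
  refine le_of_tendsto_of_tendsto h1 h2 ?_
  filter_upwards [Ioo_mem_nhdsGT hx.1] with z hz
  exact da_mul_le_sub ⟨hz.1, hz.2.trans hx.2⟩ hx hz.2.le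

theorem tau_pos (hx : x ∈ Ioo (T.a i) (T.b i)) : 0 < T.τ x :=
  (mul_pos (T.da_pos i) (sub_pos.2 hx.1)).trans_le (da_mul_le hx)

theorem tau_le_one (hx : x ∈ Ioo (T.a i) (T.b i)) : T.τ x ≤ 1 :=
  (T.maps_to (T.sub i hx)).2

theorem tau_mul_sub_le (hx : T.a i < x) (hxy : x ≤ y) (hy : y < T.b i) :
    T.τ x * (y - T.a i) ≤ T.τ y * (x - T.a i) := by
  rcases hxy.eq_or_lt with rfl | hxy
  · exact le_rfl
  have hid : Tendsto (fun z : ℝ => z) (𝓝[>] T.a i) (𝓝 (T.a i)) := nhdsWithin_le_nhds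
  have h1 : Tendsto (fun z => (T.τ x - T.τ z) * (y - z)) (𝓝[>] T.a i)
      (𝓝 ((T.τ x - 0) * (y - T.a i))) :=
    (tendsto_const_nhds.sub (T.lim_zero i)).mul (tendsto_const_nhds.sub hid)
  have h2 : Tendsto (fun z => (T.τ y - T.τ z) * (x - z)) (𝓝[>] T.a i)
      (𝓝 ((T.τ y - 0) * (x - T.a i))) :=
    (tendsto_const_nhds.sub (T.lim_zero i)).mul (tendsto_const_nhds.sub hid)
  rw [sub_zero] at h1 h2
  refine le_of_tendsto_of_tendsto h1 h2 ?_
  filter_upwards [Ioo_mem_nhdsGT hx] with z hz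
  have := (T.conv i).secant_mono (a := z) (x := x) (y := y) ⟨hz.1, hz.2.trans (hxy.trans hy)⟩
    ⟨hx, hxy.trans hy⟩ ⟨hx.trans hxy, hy⟩ hz.2.ne' (hz.2.trans hxy).ne' hxy.le
  rwa [div_le_div_iff₀ (sub_pos.2 hz.2) (sub_pos.2 (hz.2.trans hxy))] at this

variable (T) in
/-- The sublevel set at height `y` of the `i`-th branch, extended by `0` at its left endpoint. -/
def sublevel (i : ℕ) (y : ℝ) : Set ℝ :=
  {x | x = T.a i ∨ (x ∈ Ioo (T.a i) (T.b i) ∧ T.τ x ≤ y)}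

variable (T) in
/-- The inverse of the `i`-th branch, extended by the right endpoint of the branch. -/
noncomputable def invBranch (i : ℕ) (y : ℝ) : ℝ := sSup (T.sublevel i y)

theorem a_mem_sublevel : T.a i ∈ T.sublevel i y := Or.inl rfl

theorem le_b_of_mem_sublevel (hx : x ∈ T.sublevel i y) : x ≤ T.b i := by
  rcases hx with rfl | hx
  · exact (T.lt i).le
  · exact hx.1.2.le

theorem bddAbove_sublevel : BddAbove (T.sublevel i y) :=
  ⟨T.b i, fun _ => le_b_of_mem_sublevel⟩

theorem a_le_invBranch : T.a i ≤ T.invBranch i y :=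
  le_csSup bddAbove_sublevel a_mem_sublevel

theorem invBranch_le_b : T.invBranch i y ≤ T.b i :=
  csSup_le ⟨_, a_mem_sublevel⟩ fun _ => le_b_of_mem_sublevel

theorem invBranch_mem : T.invBranch i y ∈ Icc (0 : ℝ) 1 :=
  ⟨(T.a_nonneg i).trans a_le_invBranch, invBranch_le_b.trans (T.b_le_one i)⟩

theorem invBranch_sub_le (hy : 0 ≤ y) : T.invBranch i y - T.a i ≤ 1 / T.da i * y := by
  rw [sub_le_iff_le_add]
  refine csSup_le ⟨_, a_mem_sublevel⟩ ?_
  rintro x (rfl | hx)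
  · have := T.da_pos i
    have : 0 ≤ 1 / T.da i * y := by positivity
    linarith
  · rw [← sub_le_iff_le_add, one_div, ← div_eq_inv_mul, le_div_iff₀ (T.da_pos i), mul_comm]
    exact (da_mul_le hx.1).trans hx.2

theorem Ioo_invBranch_subset :
    Ioo (T.a i) (T.invBranch i y) ⊆ Ioo (T.a i) (T.b i) ∩ T.τ ⁻¹' Iic y := by
  intro x hx
  have hxI : x ∈ Ioo (T.a i) (T.b i) := ⟨hx.1, hx.2.trans_le invBranch_le_b⟩
  obtain ⟨z, hz, hxz⟩ := exists_lt_of_lt_csSup ⟨_, a_mem_sublevel⟩ hx.2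
  refine ⟨hxI, ?_⟩
  rcases hz with rfl | hz
  · exact absurd hxz (not_lt.2 hx.1.le)
  · exact ((T.mono i hxI hz.1 hxz).le.trans hz.2 : T.τ x ≤ y)

theorem subset_Ioc_invBranch :
    Ioo (T.a i) (T.b i) ∩ T.τ ⁻¹' Iic y ⊆ Ioc (T.a i) (T.invBranch i y) :=
  fun _ hx => ⟨hx.1.1, le_csSup bddAbove_sublevel (Or.inr hx)⟩

theorem sublevel_convex_comb {x₁ x₂ y₁ y₂ s t : ℝ} (hy₁ : 0 ≤ y₁) (hy₂ : 0 ≤ y₂)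
    (hx₁ : x₁ ∈ T.sublevel i y₁) (hx₂ : x₂ ∈ T.sublevel i y₂) (hs : 0 < s) (ht : 0 < t)
    (hst : s + t = 1) : s * x₁ + t * x₂ ∈ T.sublevel i (s * y₁ + t * y₂) := by
  have aux : ∀ {x y s t : ℝ}, x ∈ Ioo (T.a i) (T.b i) → T.τ x ≤ y → 0 < s → 0 < t → s + t = 1 →
      s * x + t * T.a i ∈ Ioo (T.a i) (T.b i) ∧ T.τ (s * x + t * T.a i) ≤ s * y := by
    intro x y s t hx hxy hs ht hst
    obtain rfl : t = 1 - s := by linarith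
    have h1 : T.a i < s * x + (1 - s) * T.a i := by nlinarith [hx.1]
    have h2 : s * x + (1 - s) * T.a i ≤ x := by nlinarith [hx.1]
    refine ⟨⟨h1, h2.trans_lt hx.2⟩, ?_⟩
    have := tau_mul_sub_le h1 h2 hx.2
    have h3 : s * x + (1 - s) * T.a i - T.a i = s * (x - T.a i) := by ring
    rw [h3, ← mul_assoc] at this
    have := le_of_mul_le_mul_right this (sub_pos.2 hx.1)
    nlinarith
  rcases hx₁ with rfl | hx₁ <;> rcases hx₂ with rfl | hx₂
  · left
    rw [← add_mul, hst, one_mul]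
  · right
    rw [add_comm]
    obtain ⟨h1, h2⟩ := aux hx₂.1 hx₂.2 ht hs (by linarith)
    exact ⟨h1, h2.trans (by nlinarith)⟩
  · right
    obtain ⟨h1, h2⟩ := aux hx₁.1 hx₁.2 hs ht hst
    exact ⟨h1, h2.trans (by nlinarith)⟩
  · right
    refine ⟨(convex_Ioo _ _) hx₁.1 hx₂.1 hs.le ht.le hst, ?_⟩
    have := (T.conv i).2 hx₁.1 hx₂.1 hs.le ht.le hst
    simp only [smul_eq_mul] at this
    nlinarith [hx₁.2, hx₂.2]

theorem concaveOn_invBranch : ConcaveOn ℝ (Icc 0 1) (T.invBranch i) := by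
  rw [concaveOn_iff_forall_pos]
  refine ⟨convex_Icc _ _, ?_⟩
  intro y₁ hy₁ y₂ hy₂ s t hs ht hst
  simp only [smul_eq_mul]
  refine le_of_forall_pos_le_add fun ε hε => ?_
  obtain ⟨x₁, hx₁, h₁⟩ := exists_lt_of_lt_csSup ⟨_, a_mem_sublevel⟩
    (sub_lt_self (T.invBranch i y₁) hε)
  obtain ⟨x₂, hx₂, h₂⟩ := exists_lt_of_lt_csSup ⟨_, a_mem_sublevel⟩
    (sub_lt_self (T.invBranch i y₂) hε)
  have h3 : s * x₁ + t * x₂ ≤ T.invBranch i (s * y₁ + t * y₂) :=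
    le_csSup bddAbove_sublevel (sublevel_convex_comb hy₁.1 hy₂.1 hx₁ hx₂ hs ht hst)
  have h4 := mul_le_mul_of_nonneg_left h₁.le hs.le
  have h5 := mul_le_mul_of_nonneg_left h₂.le ht.le
  have h6 : s * ε + t * ε = ε := by rw [← add_mul, hst, one_mul]
  nlinarith

variable (T) in
/-- All branches that start near `0` have a small total inverse slope. -/
theorem exists_split : ∃ (J : Set ℕ) (θ c : ℝ), 0 < c ∧ 0 < θ ∧ θ < 1 ∧
    ∑' i, J.indicator (fun i => 1 / T.da i) i ≤ θ ∧ ∀ i ∉ J, c ≤ T.a i := by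
  by_cases hacc : AccPt (0 : ℝ) (𝓟 (range T.a))
  · have hpos : ∀ j, 0 < T.a j := by
      intro j
      refine lt_of_le_of_ne (T.a_nonneg j) fun hj => ?_
      rw [accPt_iff_frequently_nhdsNE] at hacc
      have hb : 0 < T.b j := hj ▸ T.lt j
      have : ∀ᶠ y in 𝓝[≠] (0 : ℝ), y < T.b j ∧ y ≠ 0 :=
        (Eventually.filter_mono nhdsWithin_le_nhds (gt_mem_nhds hb)).and self_mem_nhdsWithin
      obtain ⟨_, ⟨i, rfl⟩, h1, h2⟩ := (hacc.and_eventually this).exists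
      have hij : j ≠ i := by rintro rfl; exact h2 hj.symm
      exact absurd (T.b_le_a hij (hj ▸ T.a_nonneg i)) (not_le.2 h1)
    have htail := tendsto_tsum_compl_atTop_zero (fun i => 1 / T.da i)
    obtain ⟨s, hs⟩ := (htail.eventually (gt_mem_nhds (show (0 : ℝ) < 1 / 2 by norm_num))).exists
    have hc : ∃ c, 0 < c ∧ ∀ i ∈ s, c ≤ T.a i := by
      clear hs
      induction s using Finset.induction_on with
      | empty => exact ⟨1, one_pos, by simp⟩
      | insert j s _ ih =>
        obtain ⟨c, hc, h⟩ := ih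
        refine ⟨min c (T.a j), lt_min hc (hpos j), fun i hi => ?_⟩
        rcases Finset.mem_insert.1 hi with rfl | hi
        · exact min_le_right _ _
        · exact (min_le_left _ _).trans (h i hi)
    obtain ⟨c, hc, h⟩ := hc
    refine ⟨{i | i ∉ s}, 1 / 2, c, hc, by norm_num, by norm_num, ?_,
      fun i hi => h i (by simpa using hi)⟩
    rw [← tsum_subtype]
    exact hs.le
  · obtain ⟨i, hi, hda⟩ := T.expand hacc
    refine ⟨{i}, 1 / T.da i, T.b i, hi ▸ T.lt i, by positivity, ?_, ?_, fun j hj => ?_⟩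
    · rw [div_lt_one (by linarith)]; exact hda
    · rw [← tsum_subtype, tsum_singleton i (fun i => 1 / T.da i)]
    · exact T.b_le_a (Ne.symm hj) (hi ▸ T.a_nonneg j)

/-- The image of an interval under a branch is an interval; its length and its ratio of endpoints
are controlled by convexity. -/
theorem image_Ioo {c d : ℝ} (hcd : c < d) (hc : T.a i ≤ c) (hd : d ≤ T.b i) :
    ∃ c' e, T.τ '' Ioo c d = Ioo c' e ∧ (c = T.a i → c' = 0) ∧
      0 ≤ c' ∧ e ≤ 1 ∧ T.da i * (d - c) ≤ e - c' ∧
      (T.a i < c → 0 < c' ∧ c' * (d - T.a i) ≤ e * (c - T.a i)) := by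
  have hsub : ∀ {x}, x ∈ Ioo c d → x ∈ Ioo (T.a i) (T.b i) := fun hx =>
    ⟨hc.trans_lt hx.1, hx.2.trans_le hd⟩
  obtain ⟨c', hlim, hlt, hc0, hnn, hda, hratio⟩ : ∃ c', Tendsto T.τ (𝓝[>] c) (𝓝 c') ∧
      (∀ x ∈ Ioo c d, c' < T.τ x) ∧ (c = T.a i → c' = 0) ∧ 0 ≤ c' ∧
      (∀ x ∈ Ioo c d, T.da i * (x - c) ≤ T.τ x - c') ∧
      (T.a i < c → 0 < c' ∧ ∀ x ∈ Ioo c d, c' * (x - T.a i) ≤ T.τ x * (c - T.a i)) := by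
    rcases hc.eq_or_lt with rfl | hc
    · exact ⟨0, T.lim_zero i, fun x hx => tau_pos (hsub hx), fun _ => rfl, le_rfl,
        fun x hx => by simpa using da_mul_le (hsub hx), fun h => absurd h (lt_irrefl _)⟩
    · have hcI : c ∈ Ioo (T.a i) (T.b i) := ⟨hc, hcd.trans_le hd⟩
      exact ⟨T.τ c, (continuousAt hcI).mono_left nhdsWithin_le_nhds,
        fun x hx => T.mono i hcI (hsub hx) hx.1, fun h => absurd h hc.ne', (tau_pos hcI).le,
        fun x hx => da_mul_le_sub hcI (hsub hx) hx.1.le,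
        fun _ => ⟨tau_pos hcI, fun x hx => tau_mul_sub_le hc hx.1.le (hx.2.trans_le hd)⟩⟩
  have hbdd : BddAbove (T.τ '' Ioo c d) :=
    ⟨1, by rintro _ ⟨x, hx, rfl⟩; exact tau_le_one (hsub hx)⟩
  have hne : (T.τ '' Ioo c d).Nonempty := (nonempty_Ioo.2 hcd).image _
  have hle : ∀ x ∈ Ioo c d, T.τ x ≤ sSup (T.τ '' Ioo c d) := fun x hx =>
    le_csSup hbdd (mem_image_of_mem _ hx)
  have hleft : ∀ᶠ x in 𝓝[<] d, x ∈ Ioo c d := Ioo_mem_nhdsLT hcd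
  have hid : Tendsto (fun z : ℝ => z) (𝓝[<] d) (𝓝 d) := nhdsWithin_le_nhds
  refine ⟨c', sSup (T.τ '' Ioo c d), ?_, hc0, hnn, ?_, ?_, fun h => ⟨(hratio h).1, ?_⟩⟩
  · apply Subset.antisymm
    · rintro _ ⟨x, hx, rfl⟩
      obtain ⟨z, hz1, hz2⟩ := exists_between hx.2
      have hz : z ∈ Ioo c d := ⟨hx.1.trans hz1, hz2⟩
      exact ⟨hlt x hx, (T.mono i (hsub hx) (hsub hz) hz1).trans_le (hle z hz)⟩
    · intro y hy
      obtain ⟨_, ⟨x₂, hx₂, rfl⟩, h₂⟩ := exists_lt_of_lt_csSup hne hy.2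
      obtain ⟨x₁, h₁, hx₁⟩ := ((hlim.eventually (gt_mem_nhds hy.1)).and
        (Ioo_mem_nhdsGT hx₂.1)).exists
      have hsub' : Icc x₁ x₂ ⊆ Ioo c d := fun z hz =>
        ⟨hx₁.1.trans_le hz.1, hz.2.trans_lt hx₂.2⟩
      obtain ⟨x, hx, rfl⟩ := intermediate_value_Icc hx₁.2.le
        (fun z hz => (continuousAt (hsub (hsub' hz))).continuousWithinAt) ⟨h₁.le, h₂.le⟩
      exact ⟨x, hsub' hx, rfl⟩
  · exact csSup_le hne (by rintro _ ⟨x, hx, rfl⟩; exact tau_le_one (hsub hx))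
  · refine le_of_tendsto (tendsto_const_nhds.mul (hid.sub tendsto_const_nhds)) ?_
    filter_upwards [hleft] with x hx
    exact (hda x hx).trans (sub_le_sub_right (hle x hx) _)
  · refine le_of_tendsto (tendsto_const_nhds.mul (hid.sub tendsto_const_nhds)) ?_
    filter_upwards [hleft] with x hx
    exact ((hratio h).2 x hx).trans
      (mul_le_mul_of_nonneg_right (hle x hx) (sub_nonneg.2 h.le))

end PCT

/-- Lebesgue measure on the unit interval. -/
noncomputable abbrev unitVolume : Measure ℝ := volume.restrict (Icc 0 1)

theorem Iic_inter_Icc_zero_one {y : ℝ} (hy : y ≤ 1) : Iic y ∩ Icc 0 1 = Icc 0 y := by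
  ext x
  simp only [mem_inter_iff, mem_Iic, mem_Icc]
  exact ⟨fun h => ⟨h.2.1, h.1⟩, fun h => ⟨h.2, h.1, h.2.trans hy⟩⟩

theorem unitVolume_real_Iic {y : ℝ} (hy : y ≤ 1) : unitVolume.real (Iic y) = max y 0 := by
  rw [measureReal_restrict_apply measurableSet_Iic, Iic_inter_Icc_zero_one hy,
    Real.volume_real_Icc, sub_zero]

theorem unitVolume_eq_zero_of_disjoint {A : Set ℝ} (hA : MeasurableSet A)
    (h : A ∩ Icc 0 1 = ∅) : unitVolume A = 0 := by
  rw [Measure.restrict_apply hA, h, measure_empty]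

/-- Variant of `eq_zero_of_additive_of_Iic` on the unit interval. -/
theorem eq_zero_of_additive_of_unitVolume {d : Set ℝ → ℝ} {C : ℝ}
    (hadd : ∀ A B, MeasurableSet A → MeasurableSet B → Disjoint A B → d (A ∪ B) = d A + d B)
    (hle : ∀ A, MeasurableSet A → |d A| ≤ C * unitVolume.real A)
    (hIic : ∀ y ∈ Icc (0 : ℝ) 1, d (Iic y) = 0) {A : Set ℝ} (hA : MeasurableSet A) :
    d A = 0 := by
  have hnull : ∀ B, MeasurableSet B → B ∩ Icc 0 1 = ∅ → d B = 0 := by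
    intro B hB h
    have := hle B hB
    rw [measureReal_def, unitVolume_eq_zero_of_disjoint hB h] at this
    simpa using this
  have h1 := hIic 1 ⟨zero_le_one, le_rfl⟩
  refine eq_zero_of_additive_of_Iic hadd hle ?_ (fun y => ?_) hA
  · rw [← Iic_union_Ioi (a := (1 : ℝ)), hadd _ _ measurableSet_Iic measurableSet_Ioi
      (Iic_disjoint_Ioi le_rfl), h1, zero_add]
    refine hnull _ measurableSet_Ioi ?_
    ext x; simp; intros; linarith
  · rcases lt_or_ge y 0 with hy0 | hy0
    · refine hnull _ measurableSet_Iic ?_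
      ext x; simp; intros; linarith
    rcases le_or_gt y 1 with hy1 | hy1
    · exact hIic y ⟨hy0, hy1⟩
    · rw [← Iic_union_Ioc_eq_Iic hy1.le, hadd _ _ measurableSet_Iic measurableSet_Ioc
        (disjoint_left.2 fun x hx hx' => absurd hx'.1 (not_lt.2 hx)), h1, zero_add]
      refine hnull _ measurableSet_Ioc ?_
      ext x; simp; intros; linarith

theorem Antitone.integrable_unitVolume {g : ℝ → ℝ} (hg : Antitone g) : Integrable g unitVolume :=
  (hg.antitoneOn _).integrableOn_isCompact isCompact_Icc

theorem setIntegral_unitVolume_Iic (g : ℝ → ℝ) {y : ℝ} (hy : y ∈ Icc (0 : ℝ) 1) :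
    ∫ x in Iic y, g x ∂unitVolume = ∫ x in (0 : ℝ)..y, g x := by
  rw [Measure.restrict_restrict measurableSet_Iic, Iic_inter_Icc_zero_one hy.2,
    intervalIntegral.integral_of_le hy.1, integral_Icc_eq_integral_Ioc]

theorem ae_unitVolume_of_Ioo {p : ℝ → Prop} (h : ∀ x ∈ Ioo (0 : ℝ) 1, p x) :
    ∀ᵐ x ∂unitVolume, p x := by
  rw [unitVolume, ← restrict_Ioo_eq_restrict_Icc]
  exact (ae_restrict_iff' measurableSet_Ioo).2 (ae_of_all _ h)

theorem abs_setIntegral_unitVolume_le {g : ℝ → ℝ} {M : ℝ}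
    (hg : ∀ x ∈ Ioo (0 : ℝ) 1, 0 ≤ g x ∧ g x ≤ M) (A : Set ℝ) :
    |∫ x in A, g x ∂unitVolume| ≤ M * unitVolume.real A := by
  rw [← Real.norm_eq_abs]
  refine norm_setIntegral_le_of_norm_le_const_ae (measure_lt_top unitVolume A) (ae_restrict_of_ae ?_)
  refine ae_unitVolume_of_Ioo fun x hx => ?_
  rw [Real.norm_eq_abs, abs_of_nonneg (hg x hx).1]
  exact (hg x hx).2

/-- Measures on the unit interval with a concave distribution function. -/
structure HasConcaveCDF (M : ℝ) (ν : Measure ℝ) : Prop where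
  finite : IsFiniteMeasure ν
  compl_eq_zero : ν (Icc 0 1)ᶜ = 0
  cdf : IsConcaveCDF M (fun y => ν.real (Iic y))

namespace HasConcaveCDF

variable {M : ℝ} {ν : Measure ℝ}

theorem measureReal_le (hν : HasConcaveCDF M ν) {A : Set ℝ} (hA : MeasurableSet A) :
    ν.real A ≤ M * unitVolume.real A := by
  have := hν.finite
  obtain ⟨g, hg, hbound, hprim⟩ := hν.cdf.exists_density
  have hgi := hg.integrable_unitVolume
  have hnn : 0 ≤ᵐ[unitVolume] g := ae_unitVolume_of_Ioo fun x hx => (hbound x hx).1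
  have hdens : ∀ B, MeasurableSet B → unitVolume.withDensity (fun x => ENNReal.ofReal (g x)) B =
      ENNReal.ofReal (∫ x in B, g x ∂unitVolume) := by
    intro B hB
    rw [withDensity_apply _ hB, ofReal_integral_eq_lintegral_ofReal hgi.integrableOn
      (ae_restrict_of_ae hnn)]
  have hzero : unitVolume.withDensity (fun x => ENNReal.ofReal (g x)) (Icc 0 1)ᶜ = 0 :=
    withDensity_absolutelyContinuous _ _
      (unitVolume_eq_zero_of_disjoint measurableSet_Icc.compl (by simp))
  have hclamp : ∀ (ρ : Measure ℝ), ρ (Icc 0 1)ᶜ = 0 → ∀ y, 1 ≤ y → ρ (Iic y) = ρ (Iic 1) := by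
    intro ρ hρ y hy
    refine le_antisymm ?_ (measure_mono (Iic_subset_Iic.2 hy))
    calc ρ (Iic y) ≤ ρ (Iic 1 ∪ (Icc 0 1)ᶜ) := measure_mono fun x _ => by
          by_cases h : x ≤ 1
          · exact Or.inl h
          · exact Or.inr fun h' => h h'.2
      _ ≤ ρ (Iic 1) + ρ (Icc 0 1)ᶜ := measure_union_le _ _
      _ = ρ (Iic 1) := by rw [hρ, add_zero]
  have hneg : ∀ (ρ : Measure ℝ), ρ (Icc 0 1)ᶜ = 0 → ∀ y < 0, ρ (Iic y) = 0 := by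
    intro ρ hρ y hy
    refine measure_mono_null (t := (Icc 0 1)ᶜ) (fun x hx => ?_) hρ
    exact fun h' => absurd h'.1 (not_le.2 (lt_of_le_of_lt hx hy))
  have hmid : ∀ y ∈ Icc (0 : ℝ) 1,
      ν (Iic y) = unitVolume.withDensity (fun x => ENNReal.ofReal (g x)) (Iic y) := by
    intro y hy
    rw [hdens _ measurableSet_Iic, setIntegral_unitVolume_Iic g hy, hprim y hy,
      ofReal_measureReal]
  have heq : ν = unitVolume.withDensity (fun x => ENNReal.ofReal (g x)) := by
    refine Measure.ext_of_Iic _ _ fun y => ?_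
    rcases lt_or_ge y 0 with hy0 | hy0
    · rw [hneg _ hν.compl_eq_zero y hy0, hneg _ hzero y hy0]
    rcases le_or_gt y 1 with hy1 | hy1
    · exact hmid y ⟨hy0, hy1⟩
    · rw [hclamp _ hν.compl_eq_zero y hy1.le, hclamp _ hzero y hy1.le,
        hmid 1 ⟨zero_le_one, le_rfl⟩]
  have hnn' : 0 ≤ ∫ x in A, g x ∂unitVolume := integral_nonneg_of_ae (ae_restrict_of_ae hnn)
  rw [measureReal_def, heq, hdens A hA, ENNReal.toReal_ofReal hnn']
  exact (le_abs_self _).trans (abs_setIntegral_unitVolume_le hbound A)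

theorem eq_zero_of_unitVolume (hν : HasConcaveCDF M ν) {A : Set ℝ} (hA : MeasurableSet A)
    (h : unitVolume A = 0) : ν A = 0 := by
  have := hν.finite
  have := hν.measureReal_le hA
  rw [measureReal_def unitVolume, h] at this
  have h0 : ν.real A = 0 := le_antisymm (by simpa using this) measureReal_nonneg
  rwa [measureReal_eq_zero_iff] at h0

end HasConcaveCDF

theorem hasConcaveCDF_restrict_Iic {M : ℝ} (hM : 1 ≤ M) (x : ℝ) :
    HasConcaveCDF M (unitVolume.restrict (Iic x)) := by
  have hcdf : ∀ y ∈ Icc (0 : ℝ) 1,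
      (unitVolume.restrict (Iic x)).real (Iic y) = min (max x 0) y := by
    intro y hy
    rw [measureReal_restrict_apply measurableSet_Iic, Iic_inter_Iic,
      unitVolume_real_Iic ((min_le_left _ _).trans hy.2), max_min_distrib_right,
      max_eq_left hy.1, min_comm]
  refine ⟨inferInstance, ?_, ?_, ?_, ?_, ?_, ?_⟩
  · exact Measure.absolutelyContinuous_of_le Measure.restrict_le_self
      (unitVolume_eq_zero_of_disjoint measurableSet_Icc.compl (by simp))
  · refine ConcaveOn.congr (f := fun y => min (max x 0) y) ?_ fun y hy => (hcdf y hy).symm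
    exact (concaveOn_const _ (convex_Icc _ _)).inf (concaveOn_id (convex_Icc _ _))
  · exact fun y _ z _ hyz => measureReal_mono (Iic_subset_Iic.2 hyz)
  · show (unitVolume.restrict (Iic x)).real (Iic 0) = 0
    rw [hcdf 0 ⟨le_rfl, zero_le_one⟩]; simp
  · intro y hy
    show (unitVolume.restrict (Iic x)).real (Iic y) ≤ M * y
    rw [hcdf y hy]
    exact (min_le_right _ _).trans (le_mul_of_one_le_left hy.1 hM)
  · show (unitVolume.restrict (Iic x)).real (Iic 1) ≤ 1
    rw [hcdf 1 ⟨zero_le_one, le_rfl⟩]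
    exact min_le_right _ _

namespace PCT

variable (T : PCT)

/-- The union of the branch domains. -/
def domain : Set ℝ := ⋃ i, Ioo (T.a i) (T.b i)

/-- A Borel measurable version of the map, equal to `0` off the branch domains. -/
noncomputable def step : ℝ → ℝ := T.domain.indicator T.τ

theorem isOpen_domain : IsOpen T.domain := isOpen_iUnion fun _ => isOpen_Ioo

theorem measurable_step : Measurable T.step := by
  classical
  rw [step, ← piecewise_eq_indicator]
  refine ContinuousOn.measurable_piecewise ?_ continuousOn_const T.isOpen_domain.measurableSet
  intro x hx
  obtain ⟨i, hi⟩ := mem_iUnion.1 hx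
  exact (continuousAt hi).continuousWithinAt

variable {T} in
theorem step_eq {x : ℝ} (hx : x ∈ T.domain) : T.step x = T.τ x :=
  indicator_of_mem hx _

theorem step_mem (x : ℝ) : T.step x ∈ Icc (0 : ℝ) 1 := by
  by_cases hx : x ∈ T.domain
  · rw [step_eq hx]
    obtain ⟨i, hi⟩ := mem_iUnion.1 hx
    exact T.maps_to (T.sub i hi)
  · rw [step, indicator_of_notMem hx]
    exact ⟨le_rfl, zero_le_one⟩

theorem unitVolume_compl_domain : unitVolume T.domainᶜ = 0 := by
  rw [Measure.restrict_apply T.isOpen_domain.measurableSet.compl, inter_comm, ← sdiff_eq]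
  exact T.null

theorem hasSum_cdf_map {M : ℝ} {ν : Measure ℝ} (hν : HasConcaveCDF M ν) (y : ℝ) :
    HasSum (fun i => ν.real (Iic (T.invBranch i y)) - ν.real (Iic (T.a i)))
      ((ν.map T.step).real (Iic y)) := by
  have := hν.finite
  have hatom : ∀ z, ν {z} = 0 := fun z =>
    hν.eq_zero_of_unitVolume (measurableSet_singleton z) (measure_singleton z)
  have hpre : T.step ⁻¹' Iic y ∩ T.domain = ⋃ i, (Ioo (T.a i) (T.b i) ∩ T.τ ⁻¹' Iic y) := by
    ext x
    simp only [mem_inter_iff, mem_iUnion, mem_preimage, mem_Iic]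
    constructor
    · rintro ⟨h, hx⟩
      obtain ⟨i, hi⟩ := mem_iUnion.1 hx
      exact ⟨i, hi, step_eq hx ▸ h⟩
    · rintro ⟨i, hi, h⟩
      have hx : x ∈ T.domain := mem_iUnion.2 ⟨i, hi⟩
      exact ⟨(step_eq hx).symm ▸ h, hx⟩
  have hae : ∀ i, ν (Ioo (T.a i) (T.b i) ∩ T.τ ⁻¹' Iic y) = ν (Ioc (T.a i) (T.invBranch i y)) := by
    intro i
    refine le_antisymm (measure_mono subset_Ioc_invBranch) ?_
    calc ν (Ioc (T.a i) (T.invBranch i y))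
        ≤ ν (Ioo (T.a i) (T.invBranch i y) ∪ {T.invBranch i y}) := measure_mono fun x hx => by
          rcases hx.2.eq_or_lt with h | h
          · exact Or.inr h
          · exact Or.inl ⟨hx.1, h⟩
      _ ≤ ν (Ioo (T.a i) (T.invBranch i y)) + ν {T.invBranch i y} := measure_union_le _ _
      _ = ν (Ioo (T.a i) (T.invBranch i y)) := by rw [hatom, add_zero]
      _ ≤ _ := measure_mono Ioo_invBranch_subset
  have hmeas : ∀ i, MeasurableSet (Ioo (T.a i) (T.b i) ∩ T.τ ⁻¹' Iic y) := by
    intro i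
    have : Ioo (T.a i) (T.b i) ∩ T.τ ⁻¹' Iic y = Ioo (T.a i) (T.b i) ∩ T.step ⁻¹' Iic y := by
      ext x
      refine and_congr_right fun hx => ?_
      rw [mem_preimage, mem_preimage, step_eq (mem_iUnion.2 ⟨i, hx⟩)]
    rw [this]
    exact measurableSet_Ioo.inter (T.measurable_step measurableSet_Iic)
  have htot : (ν.map T.step) (Iic y) = ∑' i, ν (Ioc (T.a i) (T.invBranch i y)) := by
    rw [Measure.map_apply T.measurable_step measurableSet_Iic,
      ← measure_inter_conull (t := T.domain) (hν.eq_zero_of_unitVolume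
        T.isOpen_domain.measurableSet.compl T.unitVolume_compl_domain), hpre,
      measure_iUnion (fun i j hij => (T.disj hij).mono inter_subset_left inter_subset_left) hmeas]
    exact tsum_congr hae
  have hfin : ∑' i, ν (Ioc (T.a i) (T.invBranch i y)) ≠ ⊤ := by
    rw [← htot]
    exact measure_ne_top _ _
  have := ENNReal.hasSum_toReal hfin
  rw [← ENNReal.tsum_toReal_eq (fun i => measure_ne_top _ _), ← htot] at this
  rw [← measureReal_def] at this
  convert this using 2 with i
  have hdisj : Disjoint (Iic (T.a i)) (Ioc (T.a i) (T.invBranch i y)) :=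
    disjoint_left.2 fun x hx hx' => absurd hx'.1 (not_lt.2 hx)
  rw [← Iic_union_Ioc_eq_Iic (a_le_invBranch (T := T) (i := i) (y := y)),
    measureReal_union hdisj measurableSet_Ioc,
    add_sub_cancel_left, measureReal_def]
end PCT

namespace PCT

variable (T : PCT)

/-- A Lasota–Yorke type bound: some cone of concave distribution functions is preserved. -/
theorem exists_invariant_bound : ∃ M : ℝ, 1 ≤ M ∧
    ∀ ν, HasConcaveCDF M ν → HasConcaveCDF M (ν.map T.step) := by
  obtain ⟨J, θ, c, hc, hθ0, hθ1, hJ, hJc⟩ := T.exists_split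
  set K : ℝ := ∑' i, 1 / T.da i with hK
  set M : ℝ := max 1 (K / (c * (1 - θ))) with hM
  have hM0 : 0 ≤ M := zero_le_one.trans (le_max_left _ _)
  have hMK : M * θ + 1 / c * K ≤ M := by
    have h1 : K / (c * (1 - θ)) ≤ M := le_max_right _ _
    rw [div_le_iff₀ (mul_pos hc (sub_pos.2 hθ1))] at h1
    have h2 : 1 / c * K ≤ M * (1 - θ) := by
      rw [one_div, ← div_eq_inv_mul, div_le_iff₀ hc]
      linarith
    linarith
  have hinv : ∀ i, 0 ≤ 1 / T.da i := fun i => (one_div_pos.2 (T.da_pos i)).le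
  have hsumJ : Summable (J.indicator fun i => 1 / T.da i) := T.sum_inv.indicator J
  refine ⟨M, le_max_left _ _, fun ν hν => ?_⟩
  have hfin := hν.finite
  have hF := hν.cdf
  set F : ℝ → ℝ := fun y => ν.real (Iic y) with hFdef
  have hsum : ∀ y, HasSum (fun i => F (T.invBranch i y) - F (T.a i))
    ((ν.map T.step).real (Iic y)) := fun y => T.hasSum_cdf_map hν y
  have ha : ∀ i, T.a i ∈ Icc (0 : ℝ) 1 := fun i =>
    ⟨T.a_nonneg i, (T.lt i).le.trans (T.b_le_one i)⟩
  have hterm : ∀ y, 0 ≤ y → ∀ i, F (T.invBranch i y) - F (T.a i) ≤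
      (M * J.indicator (fun i => 1 / T.da i) i + 1 / c * (1 / T.da i)) * y := by
    intro y hy i
    have hφ := invBranch_sub_le (T := T) (i := i) hy
    have hmem := invBranch_mem (T := T) (i := i) (y := y)
    have hle := a_le_invBranch (T := T) (i := i) (y := y)
    have hcy : 0 ≤ 1 / c * (1 / T.da i) * y := by have := hinv i; positivity
    by_cases hi : i ∈ J
    · rw [indicator_of_mem hi]
      have h1 := hF.sub_le_mul (ha i).1 hle hmem.2
      have h2 := mul_le_mul_of_nonneg_left hφ hM0
      nlinarith
    · rw [indicator_of_notMem hi]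
      have hac := hJc i hi
      have ha0 := hc.trans_le hac
      have h1 := hF.sub_le_div_mul ha0 hle hmem.2
      have h2 : F (T.a i) ≤ 1 :=
        (hF.mono (ha i) ⟨zero_le_one, le_rfl⟩ (ha i).2).trans hF.le_one
      have h3 : F (T.a i) / T.a i ≤ 1 / c := div_le_div₀ zero_le_one h2 hc hac
      have h4 : F (T.a i) / T.a i * (T.invBranch i y - T.a i) ≤ 1 / c * (1 / T.da i * y) :=
        mul_le_mul h3 hφ (sub_nonneg.2 hle) (by positivity)
      nlinarith
  have hmul : ∀ y, 0 ≤ y → (ν.map T.step).real (Iic y) ≤ M * y := by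
    intro y hy
    have h1 : HasSum (fun i => (M * J.indicator (fun i => 1 / T.da i) i + 1 / c * (1 / T.da i)) * y)
        ((M * (∑' i, J.indicator (fun i => 1 / T.da i) i) + 1 / c * K) * y) :=
      ((hsumJ.hasSum.mul_left M).add (T.sum_inv.hasSum.mul_left (1 / c))).mul_right y
    refine (hasSum_le (hterm y hy) (hsum y) h1).trans (mul_le_mul_of_nonneg_right ?_ hy)
    exact (add_le_add_left (mul_le_mul_of_nonneg_left hJ hM0) _).trans hMK
  have hcompl : ν.map T.step (Icc 0 1)ᶜ = 0 := by
    rw [Measure.map_apply T.measurable_step measurableSet_Icc.compl]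
    convert measure_empty (μ := ν)
    exact eq_empty_of_forall_notMem fun x hx => hx (T.step_mem x)
  refine ⟨inferInstance, hcompl, ⟨convex_Icc _ _, ?_⟩, ?_, ?_, fun y hy => hmul y hy.1, ?_⟩
  · intro y₁ hy₁ y₂ hy₂ s t hs ht hst
    simp only [smul_eq_mul]
    refine hasSum_le (fun i => ?_) (((hsum y₁).mul_left s).add ((hsum y₂).mul_left t))
      (hsum (s * y₁ + t * y₂))
    have h1 := hF.concave.2 (invBranch_mem (T := T) (i := i) (y := y₁))
      (invBranch_mem (T := T) (i := i) (y := y₂)) hs ht hst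
    have h2 := (concaveOn_invBranch (T := T) (i := i)).2 hy₁ hy₂ hs ht hst
    have h3 := hF.mono ((convex_Icc _ _) (invBranch_mem (T := T) (i := i) (y := y₁))
      (invBranch_mem (T := T) (i := i) (y := y₂)) hs ht hst) invBranch_mem h2
    have h4 : s * F (T.a i) + t * F (T.a i) = F (T.a i) := by rw [← add_mul, hst, one_mul]
    simp only [smul_eq_mul] at h1 h3
    show s * (F _ - F _) + t * (F _ - F _) ≤ _
    nlinarith
  · exact fun y _ z _ hyz => measureReal_mono (Iic_subset_Iic.2 hyz)
  · refine le_antisymm ?_ measureReal_nonneg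
    simpa using hmul 0 le_rfl
  · show (ν.map T.step).real (Iic 1) ≤ 1
    refine le_trans ?_ hF.le_one
    have h1 : T.step ⁻¹' Iic 1 ⊆ Iic 1 ∪ (Icc 0 1)ᶜ := fun x _ => by
      by_cases h : x ≤ 1
      · exact Or.inl h
      · exact Or.inr fun h' => h h'.2
    rw [map_measureReal_apply T.measurable_step measurableSet_Iic]
    refine (measureReal_mono h1).trans ((measureReal_union_le _ _).trans ?_)
    rw [measureReal_def ν (Icc 0 1)ᶜ, hν.compl_eq_zero]
    simp [hFdef]

theorem measurable_iterate_step (n : ℕ) : Measurable T.step^[n] := T.measurable_step.iterate n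

theorem hasConcaveCDF_map_iterate {M : ℝ}
    (h : ∀ ν, HasConcaveCDF M ν → HasConcaveCDF M (ν.map T.step)) {ν : Measure ℝ}
    (hν : HasConcaveCDF M ν) (n : ℕ) : HasConcaveCDF M (ν.map T.step^[n]) := by
  induction n with
  | zero => simpa using hν
  | succ n ih =>
    rw [Function.iterate_succ', ← Measure.map_map T.measurable_step (T.measurable_iterate_step n)]
    exact h _ ih

/-- The time averages of the indicator of `Iic x` under the transfer operator have an antitone
limit density. -/
theorem exists_limit_density (x : ℝ) : ∃ g : ℝ → ℝ, Antitone g ∧ ∀ A, MeasurableSet A →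
    cesaroLim (fun n => unitVolume.real (Iic x ∩ T.step^[n] ⁻¹' A)) =
      ∫ t in A, g t ∂unitVolume := by
  obtain ⟨M, hM1, hM⟩ := T.exists_invariant_bound
  set ν : ℕ → Measure ℝ := fun n => (unitVolume.restrict (Iic x)).map T.step^[n]
  have hν : ∀ n, HasConcaveCDF M (ν n) :=
    T.hasConcaveCDF_map_iterate hM (hasConcaveCDF_restrict_Iic hM1 x)
  have hfin : ∀ n, IsFiniteMeasure (ν n) := fun n => (hν n).finite
  have hval : ∀ n A, MeasurableSet A →
      unitVolume.real (Iic x ∩ T.step^[n] ⁻¹' A) = (ν n).real A := by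
    intro n A hA
    rw [map_measureReal_apply (T.measurable_iterate_step n) hA,
      measureReal_restrict_apply (T.measurable_iterate_step n hA), inter_comm]
  have hb : ∀ A, MeasurableSet A → ∀ n, |(ν n).real A| ≤ M * unitVolume.real A := by
    intro A hA n
    rw [abs_of_nonneg measureReal_nonneg]
    exact (hν n).measureReal_le hA
  have hbI : ∀ y n, |(ν n).real (Iic y)| ≤ M * unitVolume.real (Iic y) :=
    fun y => hb _ measurableSet_Iic
  have hcdf : IsConcaveCDF M fun y => cesaroLim fun n => (ν n).real (Iic y) := by
    refine ⟨⟨convex_Icc _ _, ?_⟩, ?_, ?_, ?_, ?_⟩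
    · intro y₁ hy₁ y₂ hy₂ s t hs ht hst
      simp only [smul_eq_mul]
      have hms : ∀ y s n, |s * (ν n).real (Iic y)| ≤ |s| * (M * unitVolume.real (Iic y)) := by
        intro y s n
        rw [abs_mul]
        exact mul_le_mul_of_nonneg_left (hbI y n) (abs_nonneg s)
      rw [← cesaroLim_const_mul (hbI y₁), ← cesaroLim_const_mul (hbI y₂),
        ← cesaroLim_add (hms y₁ s) (hms y₂ t)]
      refine cesaroLim_le_cesaroLim (fun n => (abs_add_le _ _).trans
        (add_le_add (hms y₁ s n) (hms y₂ t n))) (hbI _) fun n => ?_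
      exact (hν n).cdf.concave.2 hy₁ hy₂ hs ht hst
    · intro y hy z hz hyz
      exact cesaroLim_le_cesaroLim (hbI _) (hbI _) fun n => (hν n).cdf.mono hy hz hyz
    · have : (fun n => (ν n).real (Iic (0 : ℝ))) = fun _ => 0 := funext fun n => (hν n).cdf.zero
      simp only [this, cesaroLim_const]
    · intro y hy
      rw [← cesaroLim_const (M * y)]
      exact cesaroLim_le_cesaroLim (hbI _) (fun _ => le_rfl) fun n => (hν n).cdf.le_mul y hy
    · show cesaroLim _ ≤ 1
      refine le_of_le_of_eq ?_ (cesaroLim_const 1)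
      exact cesaroLim_le_cesaroLim (hbI _) (fun _ => le_rfl) fun n => (hν n).cdf.le_one
  obtain ⟨g, hg, hbound, hprim⟩ := hcdf.exists_density
  have hgi := hg.integrable_unitVolume
  refine ⟨g, hg, fun A hA => ?_⟩
  simp_rw [hval _ A hA]
  refine sub_eq_zero.1 (eq_zero_of_additive_of_unitVolume (C := M + M)
    (d := fun A => cesaroLim (fun n => (ν n).real A) - ∫ t in A, g t ∂unitVolume) ?_ ?_ ?_ hA)
  · intro A B hA hB hAB
    have : (fun n => (ν n).real (A ∪ B)) = fun n => (ν n).real A + (ν n).real B :=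
      funext fun n => measureReal_union hAB hB
    simp only [this, cesaroLim_add (hb A hA) (hb B hB),
      setIntegral_union hAB hB hgi.integrableOn hgi.integrableOn]
    ring
  · intro A hA
    rw [add_mul]
    exact (abs_sub _ _).trans (add_le_add (abs_cesaroLim_le (hb A hA))
      (abs_setIntegral_unitVolume_le hbound A))
  · intro y hy
    show cesaroLim _ - _ = 0
    rw [setIntegral_unitVolume_Iic g hy, hprim y hy, sub_self]

theorem abs_unitVolume_real_inter_le (B A : Set ℝ) :
    |unitVolume.real (B ∩ A)| ≤ 1 * unitVolume.real B := by
  rw [abs_of_nonneg measureReal_nonneg, one_mul]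
  exact measureReal_mono inter_subset_left

/-- A function is `step`-invariant as a density. -/
def IsInvariantDensity (f : ℝ → ℝ) : Prop :=
  ∀ A, MeasurableSet A → ∫ x in T.step ⁻¹' A, f x ∂unitVolume = ∫ x in A, f x ∂unitVolume

theorem exists_invariant_limit_density (x : ℝ) : ∃ g : ℝ → ℝ, Antitone g ∧
    T.IsInvariantDensity g ∧ ∫ t, g t ∂unitVolume = unitVolume.real (Iic x) ∧
    ∀ A, MeasurableSet A → cesaroLim (fun n => unitVolume.real (Iic x ∩ T.step^[n] ⁻¹' A)) =
      ∫ t in A, g t ∂unitVolume := by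
  obtain ⟨g, hg, hgA⟩ := T.exists_limit_density x
  refine ⟨g, hg, fun A hA => ?_, ?_, hgA⟩
  · rw [← hgA A hA, ← hgA _ (T.measurable_step hA),
      ← cesaroLim_succ fun n => abs_unitVolume_real_inter_le (Iic x) (T.step^[n] ⁻¹' A)]
    simp only [Function.iterate_succ', preimage_comp]
  · rw [← setIntegral_univ, ← hgA univ MeasurableSet.univ]
    simp only [preimage_univ, inter_univ, cesaroLim_const]

end PCT

namespace PCT

variable (T : PCT)

theorem domain_subset : T.domain ⊆ Icc 0 1 := iUnion_subset T.sub

variable {T} {A : Set ℝ}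

theorem measure_image_diff_eq_zero (hA : ∀ᵐ x, x ∈ T.domain → x ∈ A → T.τ x ∈ A) {i : ℕ}
    {c d c' e : ℝ} (hc : T.a i ≤ c) (hd : d ≤ T.b i) (hnull : volume (Ioo c d \ A) = 0)
    (himage : T.τ '' Ioo c d = Ioo c' e) : volume (Ioo c' e \ A) = 0 := by
  set N : Set ℝ := {x | ¬(x ∈ T.domain → x ∈ A → T.τ x ∈ A)}
  have hsub : Ioo c d ⊆ Ioo (T.a i) (T.b i) := Ioo_subset_Ioo hc hd
  have hcover : Ioo c' e \ A ⊆ T.τ '' (Ioo c d ∩ ((Ioo c d \ A) ∪ N)) := by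
    rintro y ⟨hy, hyA⟩
    rw [← himage] at hy
    obtain ⟨x, hx, rfl⟩ := hy
    refine ⟨x, ⟨hx, ?_⟩, rfl⟩
    by_cases hxA : x ∈ A
    · exact Or.inr fun h => hyA (h (mem_iUnion.2 ⟨i, hsub hx⟩) hxA)
    · exact Or.inl ⟨hx, hxA⟩
  refine measure_mono_null hcover
    (addHaar_image_eq_zero_of_differentiableOn_of_addHaar_eq_zero volume ?_ ?_)
  · exact fun x hx => (T.diff i x (hsub hx.1)).differentiableWithinAt
  · exact measure_mono_null inter_subset_right (measure_union_null hnull hA)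

theorem exists_mem_Ioo_branch {c d : ℝ} (hc : 0 ≤ c) (hcd : c < d) (hd : d ≤ 1) :
    ∃ i, ∃ x ∈ Ioo c d, x ∈ Ioo (T.a i) (T.b i) := by
  by_contra! h
  have hsub : Ioo c d ⊆ Icc 0 1 \ ⋃ i, Ioo (T.a i) (T.b i) := fun x hx =>
    ⟨⟨hc.trans hx.1.le, hx.2.le.trans hd⟩, fun hx' => by
      obtain ⟨i, hi⟩ := mem_iUnion.1 hx'
      exact h i x hx hi⟩
  have := measure_mono_null hsub T.null
  rw [Real.volume_Ioo, ENNReal.ofReal_eq_zero] at this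
  linarith

theorem exists_branch_of_null (hA : ∀ᵐ x, x ∈ T.domain → x ∈ A → T.τ x ∈ A)
    (hno : ∀ δ, 0 < δ → volume (Ioo 0 δ \ A) ≠ 0) {c d : ℝ}
    (hc : 0 ≤ c) (hcd : c < d) (hd : d ≤ 1)
    (hnull : volume (Ioo c d \ A) = 0) : ∃ i, T.a i < c ∧ d ≤ T.b i := by
  have key : ∀ i x, x ∈ Ioo c d → x ∈ Ioo (T.a i) (T.b i) → T.a i < c := by
    intro i x hx hxi
    by_contra! hle
    have hlt : T.a i < min d (T.b i) := lt_min (hxi.1.trans hx.2) (T.lt i)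
    obtain ⟨c', e, himage, hc', -, -, hlen, -⟩ := image_Ioo (T := T) hlt le_rfl (min_le_right _ _)
    have := measure_image_diff_eq_zero hA le_rfl (min_le_right _ _)
      (measure_mono_null (sdiff_subset_sdiff_left (Ioo_subset_Ioo hle (min_le_left _ _))) hnull)
      himage
    rw [hc' rfl] at this hlen
    have h2 := mul_pos (T.da_pos i) (sub_pos.2 hlt)
    exact hno e (by linarith) this
  obtain ⟨i, x, hx, hxi⟩ := exists_mem_Ioo_branch (T := T) hc hcd hd
  refine ⟨i, key i x hx hxi, ?_⟩
  by_contra! hlt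
  have hcb : c < T.b i := hx.1.trans hxi.2
  obtain ⟨j, z, hz, hzj⟩ := exists_mem_Ioo_branch (T := T) (hc.trans hcb.le) hlt hd
  have hij : i ≠ j := by rintro rfl; exact absurd hzj.2 (not_lt.2 hz.1.le)
  have haj := key j z ⟨hcb.trans hz.1, hz.2⟩ hzj
  rcases le_total (T.a i) (T.a j) with h | h
  · exact absurd (T.b_le_a hij h) (not_le.2 (haj.trans hcb))
  · have := T.b_le_a hij.symm h
    linarith [hzj.2, hz.1, T.lt i]

theorem exists_image_of_null (hA : ∀ᵐ x, x ∈ T.domain → x ∈ A → T.τ x ∈ A)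
    {c d : ℝ} {i : ℕ} (hcd : c < d) (hc : T.a i < c) (hd : d ≤ T.b i)
    (hnull : volume (Ioo c d \ A) = 0) : ∃ c' e, 0 < c' ∧ c' < e ∧ e ≤ 1 ∧
      volume (Ioo c' e \ A) = 0 ∧ T.da i * (d - c) ≤ e - c' ∧
      c' * (d - c) ≤ (e - c') * (c - T.a i) := by
  obtain ⟨c', e, himage, -, -, he, hlen, hratio⟩ := image_Ioo (T := T) hcd hc.le hd
  obtain ⟨hc', hr⟩ := hratio hc
  refine ⟨c', e, hc', ?_, he, measure_image_diff_eq_zero hA hc.le hd hnull himage, hlen, ?_⟩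
  · have := mul_pos (T.da_pos i) (sub_pos.2 hcd)
    linarith
  · linarith

theorem exists_null_outside (hA : ∀ᵐ x, x ∈ T.domain → x ∈ A → T.τ x ∈ A)
    (hno : ∀ δ, 0 < δ → volume (Ioo 0 δ \ A) ≠ 0)
    {J : Set ℕ} {θ : ℝ} (hθ0 : 0 < θ) (hθ1 : θ < 1)
    (hJ : ∀ i ∈ J, 1 / T.da i ≤ θ) {s c d : ℝ} (hc : 0 < c) (hcd : c < d) (hd : d ≤ 1)
    (hnull : volume (Ioo c d \ A) = 0) (hs : s * c ≤ d - c) :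
    ∃ c' d', 0 < c' ∧ c' < d' ∧ d' ≤ 1 ∧ volume (Ioo c' d' \ A) = 0 ∧ s * c' ≤ d' - c' ∧
      ∃ i ∉ J, T.a i < c' ∧ d' ≤ T.b i := by
  obtain ⟨n, hn⟩ := exists_pow_lt_of_lt_one (sub_pos.2 hcd) hθ1
  induction n generalizing c d with
  | zero => rw [pow_zero] at hn; linarith
  | succ n ih =>
    obtain ⟨i, hai, hbi⟩ := exists_branch_of_null hA hno hc.le hcd hd hnull
    by_cases hi : i ∈ J
    · obtain ⟨c', e, hc', hce, he, hnull', hlen, hratio⟩ :=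
        exists_image_of_null hA hcd hai hbi hnull
      refine ih hc' hce he hnull' ?_ ?_
      · have ha := T.a_nonneg i
        have h1 : (e - c') * (c - T.a i) ≤ (e - c') * c :=
          mul_le_mul_of_nonneg_left (by linarith) (by linarith)
        have h2 := mul_le_mul_of_nonneg_left hs hc'.le
        refine le_of_mul_le_mul_right ?_ hc
        linarith
      · have h1 := hJ i hi
        have hda := T.da_pos i
        rw [div_le_iff₀ hda] at h1
        have h2 : 1 * (d - c) ≤ θ * T.da i * (d - c) :=
          mul_le_mul_of_nonneg_right h1 (by linarith)
        have h3 : θ * (T.da i * (d - c)) ≤ θ * (e - c') :=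
          mul_le_mul_of_nonneg_left hlen hθ0.le
        refine lt_of_mul_lt_mul_left ?_ hθ0.le
        rw [pow_succ'] at hn
        linarith
    · exact ⟨c, d, hc, hcd, hd, hnull, hs, i, hi, hai, hbi⟩

/-- A forward invariant set that contains an interval contains a neighbourhood of `0`
(modulo null sets). -/
theorem exists_null_near_zero (hA : ∀ᵐ x, x ∈ T.domain → x ∈ A → T.τ x ∈ A) {c d : ℝ}
    (hc : 0 ≤ c) (hcd : c < d) (hd : d ≤ 1) (hnull : volume (Ioo c d \ A) = 0) :
    ∃ δ, 0 < δ ∧ volume (Ioo 0 δ \ A) = 0 := by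
  by_contra! hno
  obtain ⟨J, θ, κ, hκ, hθ0, hθ1, hJsum, hJκ⟩ := T.exists_split
  have hJ : ∀ i ∈ J, 1 / T.da i ≤ θ := by
    intro i hi
    have h1 := (T.sum_inv.indicator J).le_tsum i fun j _ =>
      indicator_nonneg (fun k _ => (one_div_pos.2 (T.da_pos k)).le) j
    rw [indicator_of_mem hi] at h1
    exact h1.trans hJsum
  obtain ⟨i₀, hai₀, -⟩ := exists_branch_of_null hA hno hc hcd hd hnull
  have hc0 : 0 < c := (T.a_nonneg i₀).trans_lt hai₀
  set s : ℝ := (d - c) / c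
  have hs : 0 < s := div_pos (sub_pos.2 hcd) hc0
  have hsc : s * c ≤ d - c := (div_mul_cancel₀ _ hc0.ne').le
  have key : ∀ n : ℕ, ∃ c' d', 0 < c' ∧ c' < d' ∧ d' ≤ 1 ∧ volume (Ioo c' d' \ A) = 0 ∧
      (1 + κ) ^ n * s * c' ≤ d' - c' ∧ ∃ i ∉ J, T.a i < c' ∧ d' ≤ T.b i := by
    intro n
    induction n with
    | zero =>
      refine exists_null_outside hA hno hθ0 hθ1 hJ hc0 hcd hd hnull ?_
      rwa [pow_zero, one_mul]
    | succ n ih =>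
      obtain ⟨c, d, hc, hcd, hd, hnull, hs, i, hi, hai, hbi⟩ := ih
      obtain ⟨c', e, hc', hce, he, hnull', -, hratio⟩ :=
        exists_image_of_null hA hcd hai hbi hnull
      refine exists_null_outside hA hno hθ0 hθ1 hJ hc' hce he hnull' ?_
      have hκa := hJκ i hi
      have hκc : κ * c ≤ κ := mul_le_of_le_one_right hκ.le (hcd.le.trans hd)
      have h1 : (e - c') * (c - T.a i) ≤ (e - c') * (c * (1 - κ)) :=
        mul_le_mul_of_nonneg_left (by linarith) (by linarith)
      have h2 := mul_le_mul_of_nonneg_left hs hc'.le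
      have h3 : (1 + κ) ^ n * s * c' ≤ (e - c') * (1 - κ) := by
        refine le_of_mul_le_mul_right ?_ hc
        linarith
      calc (1 + κ) ^ (n + 1) * s * c' = (1 + κ) * ((1 + κ) ^ n * s * c') := by ring
        _ ≤ (1 + κ) * ((e - c') * (1 - κ)) := mul_le_mul_of_nonneg_left h3 (by positivity)
        _ = (e - c') - κ ^ 2 * (e - c') := by ring
        _ ≤ e - c' := sub_le_self _ (mul_nonneg (sq_nonneg κ) (by linarith))
  obtain ⟨n, hn⟩ := pow_unbounded_of_one_lt (1 / (s * κ)) (show 1 < 1 + κ by linarith)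
  obtain ⟨c', d', hc', hcd', hd', -, hs', i, hi, hai, -⟩ := key n
  rw [div_lt_iff₀ (mul_pos hs hκ)] at hn
  have h1 : (1 + κ) ^ n * s * κ ≤ (1 + κ) ^ n * s * c' :=
    mul_le_mul_of_nonneg_left ((hJκ i hi).trans hai.le) (by positivity)
  linarith

namespace IsInvariantDensity

theorem neg {r : ℝ → ℝ} (hr : T.IsInvariantDensity r) : T.IsInvariantDensity (-r) := by
  intro A hA
  simp only [Pi.neg_apply, integral_neg, hr A hA]

theorem ae_pos_step {r : ℝ → ℝ} (hr : T.IsInvariantDensity r) (hm : Measurable r)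
    (hi : Integrable r unitVolume) :
    ∀ᵐ x, x ∈ T.domain → x ∈ {x | 0 < r x} → T.τ x ∈ {x | 0 < r x} := by
  set A : Set ℝ := {x | 0 < r x} with hAdef
  have hA : MeasurableSet A := measurableSet_lt measurable_const hm
  set S : Set ℝ := T.step ⁻¹' A with hSdef
  have hS : MeasurableSet S := T.measurable_step hA
  have h1 := integral_inter_add_sdiff (s := A) hS hi.integrableOn
  have h2 := integral_inter_add_sdiff (s := S) hA hi.integrableOn
  have h3 : ∫ x in S \ A, r x ∂unitVolume ≤ 0 :=
    setIntegral_nonpos (hS.diff hA) fun x hx => not_lt.1 hx.2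
  have h4 : ∫ x in A \ S, r x ∂unitVolume ≤ 0 := by
    rw [inter_comm] at h2
    linarith [hr A hA]
  have h5 : unitVolume (A \ S) = 0 := by
    by_contra hne
    have := (setIntegral_pos_iff_support_of_nonneg_ae (μ := unitVolume) (s := A \ S) (f := r)
      ((ae_restrict_iff' (hA.diff hS)).2 (ae_of_all _ fun x hx => le_of_lt hx.1))
      hi.integrableOn).2 (by
        have hsub : A \ S ⊆ Function.support r := fun x hx => ne_of_gt hx.1
        rw [inter_eq_self_of_subset_right hsub]
        exact pos_iff_ne_zero.2 hne)
    linarith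
  rw [Measure.restrict_apply (hA.diff hS)] at h5
  refine measure_mono_null (fun x hx => ?_) h5
  have hx' : ¬(x ∈ T.domain → x ∈ A → T.τ x ∈ A) := hx
  push Not at hx'
  refine ⟨⟨hx'.2.1, ?_⟩, T.domain_subset hx'.1⟩
  rw [hSdef, mem_preimage, step_eq hx'.1]
  exact hx'.2.2

end IsInvariantDensity

theorem exists_Ioo_subset_pos {r : ℝ → ℝ} (hi : Integrable r unitVolume)
    (hcont : {x | ¬ContinuousAt r x}.Countable) (hzero : ∫ x, r x ∂unitVolume = 0)
    (hne : ¬r =ᵐ[unitVolume] 0) : ∃ c d, 0 ≤ c ∧ c < d ∧ d ≤ 1 ∧ Ioo c d ⊆ {x | 0 < r x} := by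
  have hfreq : ∃ᵐ x ∂unitVolume, 0 < r x := by
    intro h
    have hle : 0 ≤ᵐ[unitVolume] -r := by
      filter_upwards [h] with x hx
      simpa using hx
    have h0 := (integral_eq_zero_iff_of_nonneg_ae hle hi.neg).1 (by
      simp only [Pi.neg_apply, integral_neg, hzero, neg_zero])
    refine hne ?_
    filter_upwards [h0] with x hx
    simpa using hx
  have hc : ∀ᵐ x ∂unitVolume, ContinuousAt r x :=
    Measure.absolutelyContinuous_of_le Measure.restrict_le_self (hcont.measure_zero volume)
  have hIoo : ∀ᵐ x ∂unitVolume, x ∈ Ioo (0 : ℝ) 1 := ae_unitVolume_of_Ioo fun x hx => hx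
  obtain ⟨x, hx, hxc, hxI⟩ := (hfreq.and_eventually (hc.and hIoo)).exists
  have hnhds : {x | 0 < r x} ∩ Ioo 0 1 ∈ 𝓝 x :=
    inter_mem (hxc.eventually (lt_mem_nhds hx)) (isOpen_Ioo.mem_nhds hxI)
  obtain ⟨c, d, hcd, hsub⟩ := mem_nhds_iff_exists_Ioo_subset.1 hnhds
  have hlt := hcd.1.trans hcd.2
  have hsub' := (Ioo_subset_Ioo_iff hlt).1 (hsub.trans inter_subset_right)
  exact ⟨c, d, hsub'.1, hlt, hsub'.2, hsub.trans inter_subset_left⟩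

theorem IsInvariantDensity.exists_null_near_zero {r : ℝ → ℝ} (hr : T.IsInvariantDensity r)
    (hm : Measurable r) (hi : Integrable r unitVolume)
    (hcont : {x | ¬ContinuousAt r x}.Countable) (hzero : ∫ x, r x ∂unitVolume = 0)
    (hne : ¬r =ᵐ[unitVolume] 0) : ∃ δ, 0 < δ ∧ volume (Ioo 0 δ \ {x | 0 < r x}) = 0 := by
  obtain ⟨c, d, hc, hcd, hd, hsub⟩ := exists_Ioo_subset_pos hi hcont hzero hne
  exact PCT.exists_null_near_zero (hr.ae_pos_step hm hi) hc hcd hd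
    (by rw [sdiff_eq_empty.2 hsub, measure_empty])

/-- An invariant difference of antitone functions with mean zero vanishes. -/
theorem IsInvariantDensity.ae_eq_zero {g₁ g₂ : ℝ → ℝ} (h₁ : Antitone g₁) (h₂ : Antitone g₂)
    (hr : T.IsInvariantDensity (g₁ - g₂)) (hzero : ∫ x, (g₁ - g₂) x ∂unitVolume = 0) :
    g₁ - g₂ =ᵐ[unitVolume] 0 := by
  by_contra hne
  have hm : Measurable (g₁ - g₂) := h₁.measurable.sub h₂.measurable
  have hi : Integrable (g₁ - g₂) unitVolume := h₁.integrable_unitVolume.sub h₂.integrable_unitVolume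
  have hcont : {x | ¬ContinuousAt (g₁ - g₂) x}.Countable := by
    refine (h₁.countable_not_continuousAt.union h₂.countable_not_continuousAt).mono fun x hx => ?_
    by_contra h
    simp only [mem_union, mem_ofPred_eq, not_or, not_not] at h
    exact hx (h.1.sub h.2)
  have hcont' : {x | ¬ContinuousAt (-(g₁ - g₂)) x}.Countable := by
    refine hcont.mono fun x hx => ?_
    exact fun h => hx h.neg
  obtain ⟨δ₁, hδ₁, hn₁⟩ := hr.exists_null_near_zero hm hi hcont hzero hne
  obtain ⟨δ₂, hδ₂, hn₂⟩ := hr.neg.exists_null_near_zero hm.neg hi.neg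
    hcont'
    (by simpa only [Pi.neg_apply, integral_neg, neg_eq_zero] using hzero)
    (fun h => hne (by
      filter_upwards [h] with x hx
      simpa only [Pi.neg_apply, Pi.zero_apply, neg_eq_zero] using hx))
  have hnull : volume (Ioo 0 (min δ₁ δ₂)) = 0 := by
    refine measure_mono_null (fun x hx => ?_) (measure_union_null hn₁ hn₂)
    by_cases h : 0 < (g₁ - g₂) x
    · refine Or.inr ⟨⟨hx.1, hx.2.trans_le (min_le_right _ _)⟩, fun h' => ?_⟩
      have h'' : 0 < -((g₁ - g₂) x) := h'
      linarith
    · exact Or.inl ⟨⟨hx.1, hx.2.trans_le (min_le_left _ _)⟩, h⟩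
  rw [Real.volume_Ioo, ENNReal.ofReal_eq_zero] at hnull
  linarith [lt_min hδ₁ hδ₂]

end PCT

theorem Antitone.boundedVariationOn_const_mul {g : ℝ → ℝ} (hg : Antitone g) (c : ℝ) :
    BoundedVariationOn (fun x => c * g x) (Icc 0 1) := by
  have h1 : BoundedVariationOn (-g) (Icc 0 1) := by
    have := (hg.neg.monotoneOn (Icc 0 1)).locallyBoundedVariationOn 0 1
      ⟨le_rfl, zero_le_one⟩ ⟨zero_le_one, le_rfl⟩
    rwa [inter_self] at this
  have h2 := (lipschitzWith_smul (β := ℝ) (-c)).comp_boundedVariationOn h1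
  have h3 : (fun x => c * g x) = (fun x => -c • x) ∘ (-g) := by
    funext x
    simp
  rw [h3]
  exact h2

namespace PCT

variable {T : PCT}

/-- Defect between the time average and the space average of an integrable function. -/
noncomputable def averageDefect (T : PCT) (G : ℝ) (A : Set ℝ) (f : ℝ → ℝ) : ℝ :=
  cesaroLim (fun n => ∫ x in T.step^[n] ⁻¹' A, f x ∂unitVolume) - (∫ x, f x ∂unitVolume) * G

section averageDefect

variable {G : ℝ} {A : Set ℝ} {f f' : ℝ → ℝ}

theorem abs_setIntegral_le_integral_norm (hf : Integrable f unitVolume) (S : Set ℝ) :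
    |∫ x in S, f x ∂unitVolume| ≤ ∫ x, ‖f x‖ ∂unitVolume :=
  (norm_integral_le_integral_norm f).trans
    (setIntegral_le_integral hf.norm (ae_of_all _ fun x => norm_nonneg (f x)))

theorem averageDefect_add (hf : Integrable f unitVolume) (hf' : Integrable f' unitVolume) :
    T.averageDefect G A (f + f') = T.averageDefect G A f + T.averageDefect G A f' := by
  have h : ∀ S : Set ℝ, ∫ x in S, (f + f') x ∂unitVolume =
      ∫ x in S, f x ∂unitVolume + ∫ x in S, f' x ∂unitVolume := fun S =>
    integral_add hf.integrableOn hf'.integrableOn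
  simp only [averageDefect, h, integral_add' hf hf']
  rw [cesaroLim_add (fun n => abs_setIntegral_le_integral_norm hf _)
    (fun n => abs_setIntegral_le_integral_norm hf' _)]
  ring

theorem averageDefect_const_mul (hf : Integrable f unitVolume) (c : ℝ) :
    T.averageDefect G A (fun x => c * f x) = c * T.averageDefect G A f := by
  simp only [averageDefect, integral_const_mul]
  rw [cesaroLim_const_mul (fun n => abs_setIntegral_le_integral_norm hf _)]
  ring

theorem averageDefect_congr (h : f =ᵐ[unitVolume] f') :
    T.averageDefect G A f = T.averageDefect G A f' := by
  have h1 : ∀ S : Set ℝ, ∫ x in S, f x ∂unitVolume = ∫ x in S, f' x ∂unitVolume := fun S =>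
    integral_congr_ae (ae_restrict_of_ae h)
  simp only [averageDefect, h1, integral_congr_ae h]

theorem abs_averageDefect_le (hf : Integrable f unitVolume) :
    |T.averageDefect G A f| ≤ (1 + |G|) * ∫ x, ‖f x‖ ∂unitVolume := by
  have h1 := abs_cesaroLim_le fun n => abs_setIntegral_le_integral_norm hf (T.step^[n] ⁻¹' A)
  have h2 : |(∫ x, f x ∂unitVolume) * G| ≤ |G| * ∫ x, ‖f x‖ ∂unitVolume := by
    rw [abs_mul, mul_comm]
    exact mul_le_mul_of_nonneg_left (norm_integral_le_integral_norm f) (abs_nonneg G)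
  rw [averageDefect, add_mul, one_mul]
  exact (abs_sub _ _).trans (add_le_add h1 h2)

theorem averageDefect_sub (hf : Integrable f unitVolume) (hf' : Integrable f' unitVolume) :
    T.averageDefect G A (f - f') = T.averageDefect G A f - T.averageDefect G A f' := by
  have := averageDefect_add (T := T) (G := G) (A := A) (hf.sub hf') hf'
  rw [sub_add_cancel] at this
  linarith

theorem averageDefect_eq_zero
    (h : ∀ B, MeasurableSet B → T.averageDefect G A (B.indicator fun _ => 1) = 0)
    (hf : Integrable f unitVolume) : T.averageDefect G A f = 0 := by
  refine Integrable.induction (fun f => T.averageDefect G A f = 0) ?_ ?_ ?_ ?_ hf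
  · intro c B hB hBfin
    have : (B.indicator fun _ => c) = fun x => c * B.indicator (fun _ => (1 : ℝ)) x := by
      ext x
      by_cases hx : x ∈ B <;> simp [hx]
    rw [this, averageDefect_const_mul ((integrable_const 1).indicator hB), h B hB, mul_zero]
  · intro f f' _ hf hf' h h'
    rw [averageDefect_add hf hf', h, h', add_zero]
  · refine isClosed_eq (f := fun f : ℝ →₁[unitVolume] ℝ => T.averageDefect G A f) ?_
      continuous_const
    refine (LipschitzWith.of_dist_le_mul (K := ⟨1 + |G|, by positivity⟩) fun f f' => ?_).continuous
    rw [Real.dist_eq, ← averageDefect_sub (L1.integrable_coeFn f) (L1.integrable_coeFn f'),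
      dist_eq_norm, L1.norm_eq_integral_norm, ← averageDefect_congr (Lp.coeFn_sub f f')]
    exact abs_averageDefect_le (L1.integrable_coeFn (f - f'))
  · intro f f' hff' _ h
    rwa [← averageDefect_congr hff']

end averageDefect

/-- Unique ergodicity among absolutely continuous measures: the averages of every integrable
function under the transfer operator converge to a multiple of one antitone density. -/
theorem exists_averageDefect_eq_zero (T : PCT) : ∃ g : ℝ → ℝ, Antitone g ∧
    ∀ A, MeasurableSet A → ∀ f, Integrable f unitVolume →
      T.averageDefect (∫ x in A, g x ∂unitVolume) A f = 0 := by
  obtain ⟨g, hg, hginv, hg1, -⟩ := T.exists_invariant_limit_density 1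
  rw [unitVolume_real_Iic le_rfl, max_eq_left zero_le_one] at hg1
  have hgi := hg.integrable_unitVolume
  refine ⟨g, hg, fun A hA f hf => averageDefect_eq_zero (fun B hB => ?_) hf⟩
  have hval : ∀ B, MeasurableSet B →
      T.averageDefect (∫ x in A, g x ∂unitVolume) A (B.indicator fun _ => 1) =
        cesaroLim (fun n => unitVolume.real (B ∩ T.step^[n] ⁻¹' A)) -
          unitVolume.real B * ∫ x in A, g x ∂unitVolume := by
    intro B hB
    have h1 : ∀ S : Set ℝ, MeasurableSet S →
        ∫ x in S, B.indicator (fun _ => (1 : ℝ)) x ∂unitVolume = unitVolume.real (B ∩ S) := by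
      intro S hS
      exact (integral_indicator_one hB).trans (measureReal_restrict_apply hB)
    have h2 : ∫ x, B.indicator (fun _ => (1 : ℝ)) x ∂unitVolume = unitVolume.real B :=
      integral_indicator_one hB
    simp only [averageDefect, h1 _ (T.measurable_iterate_step _ hA), h2]
  rw [hval B hB]
  refine eq_zero_of_additive_of_unitVolume (C := 1 + |∫ x in A, g x ∂unitVolume|)
    (d := fun B => cesaroLim (fun n => unitVolume.real (B ∩ T.step^[n] ⁻¹' A)) -
          unitVolume.real B * ∫ x in A, g x ∂unitVolume) ?_ ?_ ?_ hB
  · intro B C hB hC hBC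
    have h1 : ∀ n, unitVolume.real ((B ∪ C) ∩ T.step^[n] ⁻¹' A) =
        unitVolume.real (B ∩ T.step^[n] ⁻¹' A) + unitVolume.real (C ∩ T.step^[n] ⁻¹' A) := by
      intro n
      rw [union_inter_distrib_right, measureReal_union (hBC.mono inter_subset_left
        inter_subset_left) (hC.inter (T.measurable_iterate_step n hA))]
    simp only [h1, measureReal_union (μ := unitVolume) hBC hC]
    rw [cesaroLim_add (fun n => abs_unitVolume_real_inter_le B _)
      (fun n => abs_unitVolume_real_inter_le C _)]
    ring
  · intro B hB
    have h1 := abs_cesaroLim_le fun n => abs_unitVolume_real_inter_le B (T.step^[n] ⁻¹' A)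
    refine (abs_sub _ _).trans ?_
    rw [abs_mul, abs_of_nonneg measureReal_nonneg, add_mul]
    linarith
  · intro y hy
    obtain ⟨k, hk, hkinv, hk1, hkA⟩ := T.exists_invariant_limit_density y
    set m := unitVolume.real (Iic y)
    have hmg : Antitone fun x => m * g x := fun x z hxz =>
      mul_le_mul_of_nonneg_left (hg hxz) measureReal_nonneg
    have hsub : ∀ S : Set ℝ, ∫ x in S, (k - fun x => m * g x) x ∂unitVolume =
        ∫ x in S, k x ∂unitVolume - m * ∫ x in S, g x ∂unitVolume := by
      intro S
      rw [integral_sub' hk.integrable_unitVolume.integrableOn hmg.integrable_unitVolume.integrableOn,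
        integral_const_mul]
    have hzero := IsInvariantDensity.ae_eq_zero (T := T) hk hmg
      (fun S hS => by rw [hsub, hsub, hkinv S hS, hginv S hS])
      (by rw [← setIntegral_univ, hsub, setIntegral_univ, setIntegral_univ, hk1, hg1, mul_one,
        sub_self])
    show cesaroLim _ - _ = 0
    rw [hkA A hA, ← hsub A, integral_congr_ae (ae_restrict_of_ae hzero)]
    simp

theorem IsInvariantDensity.iterate {f : ℝ → ℝ} (hf : T.IsInvariantDensity f) {A : Set ℝ}
    (hA : MeasurableSet A) (n : ℕ) :
    ∫ x in T.step^[n] ⁻¹' A, f x ∂unitVolume = ∫ x in A, f x ∂unitVolume := by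
  induction n with
  | zero => rfl
  | succ n ih =>
    rw [Function.iterate_succ, preimage_comp, hf _ (T.measurable_iterate_step n hA), ih]

/-- All integrable invariant densities are multiples of one antitone density. -/
theorem exists_antitone_ae_eq (T : PCT) : ∃ g : ℝ → ℝ, Antitone g ∧
    ∀ f, Integrable f unitVolume → T.IsInvariantDensity f →
      f =ᵐ[unitVolume] fun x => (∫ t, f t ∂unitVolume) * g x := by
  obtain ⟨g, hg, hgA⟩ := T.exists_averageDefect_eq_zero
  refine ⟨g, hg, fun f hf hfinv => ?_⟩
  refine Integrable.ae_eq_of_forall_setIntegral_eq _ _ hf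
    (hg.integrable_unitVolume.const_mul _) fun A hA _ => ?_
  have := hgA A hA f hf
  simp only [averageDefect, hfinv.iterate hA, cesaroLim_const] at this
  rw [integral_const_mul]
  linarith

theorem isInvariantDensity_of_fixed {f Pf : ℝ → ℝ}
    (hP : ∀ A : Set ℝ, MeasurableSet A → A ⊆ Icc (0 : ℝ) 1 →
      ∫ x in A, Pf x = ∫ x in T.τ ⁻¹' A ∩ Icc (0 : ℝ) 1, f x)
    (hfix : Pf =ᵐ[unitVolume] f) : T.IsInvariantDensity f := by
  intro A hA
  have hset : (T.step ⁻¹' A ∩ Icc 0 1 : Set ℝ) =ᵐ[volume]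
      (T.τ ⁻¹' (A ∩ Icc 0 1) ∩ Icc 0 1 : Set ℝ) := by
    have hnull : ∀ᵐ x, x ∉ Icc (0 : ℝ) 1 \ T.domain := measure_eq_zero_iff_ae_notMem.1 T.null
    filter_upwards [hnull] with x hx
    by_cases hxI : x ∈ Icc (0 : ℝ) 1
    · have hxd : x ∈ T.domain := by
        by_contra h
        exact hx ⟨hxI, h⟩
      refine propext (and_congr_left fun _ => ?_)
      show T.step x ∈ A ↔ T.τ x ∈ A ∩ Icc 0 1
      rw [step_eq hxd]
      exact ⟨fun h => ⟨h, T.maps_to hxI⟩, fun h => h.1⟩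
    · exact propext ⟨fun h => absurd h.2 hxI, fun h => absurd h.2 hxI⟩
  rw [Measure.restrict_restrict (T.measurable_step hA), Measure.restrict_restrict hA,
    setIntegral_congr_set hset, ← hP _ (hA.inter measurableSet_Icc) inter_subset_right,
    ← Measure.restrict_restrict hA]
  exact integral_congr_ae (ae_restrict_of_ae hfix)

end PCT

/-- Theorem 2.2.7 (2). Let `τ ∈ 𝒯` with Frobenius–Perron operator `P`
and unique absolutely continuous invariant probability density `h` (`P h = h`). Then the
fixed space `E₁ = {f ∈ L¹ : P f = f}` is one-dimensional (spanned by `h`) and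
`E₁ ⊆ BV_I`: every fixed point of `P` in `L¹` is a.e. a scalar multiple of `h` and has a
version of bounded variation. -/
theorem fixed_space_one_dimensional (T : PCT) (P : (ℝ → ℝ) → (ℝ → ℝ))
    (hP : ∀ f : ℝ → ℝ, MeasureTheory.IntegrableOn f (Set.Icc (0:ℝ) 1) →
      MeasureTheory.IntegrableOn (P f) (Set.Icc (0:ℝ) 1) ∧
      ∀ A : Set ℝ, MeasurableSet A → A ⊆ Set.Icc (0:ℝ) 1 →
        ∫ x in A, P f x = ∫ x in T.τ ⁻¹' A ∩ Set.Icc (0:ℝ) 1, f x)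
    (h : ℝ → ℝ)
    (hh_int : MeasureTheory.IntegrableOn h (Set.Icc (0:ℝ) 1))
    (hh_nn : ∀ x ∈ Set.Icc (0:ℝ) 1, 0 ≤ h x)
    (hh1 : ∫ x in Set.Icc (0:ℝ) 1, h x = 1)
    (hfix : P h =ᵐ[volume.restrict (Set.Icc (0:ℝ) 1)] h) :
    ∀ f : ℝ → ℝ, MeasureTheory.IntegrableOn f (Set.Icc (0:ℝ) 1) →
      P f =ᵐ[volume.restrict (Set.Icc (0:ℝ) 1)] f →
      (∃ c : ℝ, f =ᵐ[volume.restrict (Set.Icc (0:ℝ) 1)] fun x => c * h x) ∧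
      (∃ g : ℝ → ℝ, BoundedVariationOn g (Set.Icc (0:ℝ) 1) ∧
        f =ᵐ[volume.restrict (Set.Icc (0:ℝ) 1)] g) := by
  obtain ⟨g, hg, hgf⟩ := T.exists_antitone_ae_eq
  have hhg := hgf h hh_int (PCT.isInvariantDensity_of_fixed (hP h hh_int).2 hfix)
  intro f hf hffix
  have hfg := hgf f hf (PCT.isInvariantDensity_of_fixed (hP f hf).2 hffix)
  refine ⟨⟨∫ t, f t ∂unitVolume, ?_⟩, _, hg.boundedVariationOn_const_mul _, hfg⟩
  filter_upwards [hhg, hfg] with x hx hx'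
  rw [hx', hx, hh1, one_mul]
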